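/- arXiv:1307.7687 — 6 statements merged into one kernel-verified Lean document; each statement's English description precedes it below -/
import Mathlib

section
/- Let p be a prime, a, b integers with 0 ≤ b ≤ a and a ≡ b (mod p−1), and k, d integers with k ≥ 2 and d ≥ 1. For integers k' ≥ 1 and d' ≥ 0, let Y(k',d') denote the limit in ℤ_p as e → ∞ of S(p^e·a + d' − k', p^e·b + d') (these limits exist). Then d·Y(k,d) = Y(k−1,d) − Y(k−1,d−1). -/
/-- Stirling numbers of the second kind for integer arguments:
`S(n,k) = (1/k!) ∑_{i=0}^{k} (-1)^(k-i) C(k,i) i^n` for `n, k ≥ 0` (with `0^0 = 1`),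
and `S(n,k) = 0` if `n < 0` or `k < 0`. -/
def stirling2 (n k : ℤ) : ℤ :=
  if n < 0 ∨ k < 0 then 0
  else (∑ i ∈ Finset.range (k.toNat + 1),
      (-1 : ℤ) ^ (k.toNat - i) * (Nat.choose k.toNat i : ℤ) * (i : ℤ) ^ n.toNat)
    / (Nat.factorial k.toNat : ℤ)

/-- The inclusion-exclusion sum equals `k! S(n,k)`. -/
theorem sum_alternating_choose_mul_pow_eq_factorial_mul (n k : ℕ) :
    ∑ i ∈ Finset.range (k + 1), (-1 : ℤ) ^ (k - i) * (k.choose i : ℤ) * (i : ℤ) ^ n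
      = k.factorial * n.stirlingSecond k := by
  induction n generalizing k with
  | zero =>
    have h := add_pow (1 : ℤ) (-1) k
    rcases k with _ | k
    · simp
    · simp only [one_pow, one_mul, add_neg_cancel] at h
      simp only [pow_zero, mul_one, Nat.stirlingSecond_zero_succ, Nat.cast_zero, mul_zero]
      rw [← h, zero_pow (by simp)]
  | succ n ih =>
    rcases k with _ | k
    · simp
    · rw [Finset.sum_range_succ']
      have h1 := ih (k + 1)
      have h0 := ih k
      rw [Finset.sum_range_succ'] at h1
      have hstep : ∀ i ∈ Finset.range (k + 1),
          (-1 : ℤ) ^ (k + 1 - (i + 1)) * ((k + 1).choose (i + 1) : ℤ) * ((i + 1 : ℕ) : ℤ) ^ (n + 1)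
          = (k + 1) * ((-1 : ℤ) ^ (k + 1 - (i + 1)) * ((k + 1).choose (i + 1) : ℤ)
              * ((i + 1 : ℕ) : ℤ) ^ n
            - (-1 : ℤ) ^ (k + 1 - (i + 1)) * (k.choose (i + 1) : ℤ) * ((i + 1 : ℕ) : ℤ) ^ n) := by
        intro i _
        have hc : ((k + 1 : ℕ) : ℤ) * (k.choose i : ℤ)
            = ((k + 1).choose (i + 1) : ℤ) * ((i + 1 : ℕ) : ℤ) := by
          exact_mod_cast Nat.add_one_mul_choose_eq k i
        have hp : ((k + 1).choose (i + 1) : ℤ) = k.choose i + k.choose (i + 1) := by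
          exact_mod_cast Nat.choose_succ_succ k i
        have hk : ((k + 1 : ℕ) : ℤ) = k + 1 := by push_cast; ring
        rw [pow_succ]
        linear_combination (-1 : ℤ) ^ (k + 1 - (i + 1)) * ((i + 1 : ℕ) : ℤ) ^ n
          * ((k + 1) * hp * (-1) - hc + (k.choose i : ℤ) * hk)
      rw [Finset.sum_congr rfl hstep, ← Finset.mul_sum, Finset.sum_sub_distrib]
      have h2 : ∑ i ∈ Finset.range (k + 1),
          (-1 : ℤ) ^ (k + 1 - (i + 1)) * (k.choose (i + 1) : ℤ) * ((i + 1 : ℕ) : ℤ) ^ n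
          = (-1 : ℤ) ^ k * (0 : ℤ) ^ n - k.factorial * n.stirlingSecond k := by
        rw [← h0, Finset.sum_range_succ, Finset.sum_range_succ']
        have : ∑ x ∈ Finset.range k,
            (-1 : ℤ) ^ (k + 1 - (x + 1)) * (k.choose (x + 1) : ℤ) * ((x + 1 : ℕ) : ℤ) ^ n
            = - ∑ x ∈ Finset.range k,
            (-1 : ℤ) ^ (k - (x + 1)) * (k.choose (x + 1) : ℤ) * ((x + 1 : ℕ) : ℤ) ^ n := by
          rw [← Finset.sum_neg_distrib]
          refine Finset.sum_congr rfl fun x hx => ?_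
          have hx' := Finset.mem_range.1 hx
          rw [show k + 1 - (x + 1) = k - (x + 1) + 1 by omega, pow_succ]
          ring
        rw [this]
        simp
      rw [h2, Nat.stirlingSecond_succ_succ, Nat.factorial_succ]
      rw [Nat.factorial_succ] at h1
      push_cast at h1 ⊢
      simp only [Nat.choose_zero_right, Nat.cast_one, mul_one] at h1 ⊢
      rw [zero_pow (Nat.succ_ne_zero n)]
      rw [pow_succ] at h1
      linear_combination (k + 1 : ℤ) * h1

open PowerSeries

/-- `∏_{i=1}^{k} (1 - i X)`. -/
noncomputable def stirlingDenom (k : ℕ) : PowerSeries ℤ :=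
  ∏ i ∈ Finset.range k, (1 - ((i + 1 : ℕ) : PowerSeries ℤ) * X)

/-- The ordinary generating function `∑ S(n+k,k) X^n`. -/
noncomputable def stirlingSeries (k : ℕ) : PowerSeries ℤ :=
  PowerSeries.mk fun n => ((n + k).stirlingSecond k : ℤ)

theorem stirlingDenom_mul_stirlingSeries (k : ℕ) : stirlingDenom k * stirlingSeries k = 1 := by
  induction k with
  | zero =>
    ext n
    rcases n with _ | n <;> simp [stirlingDenom, stirlingSeries, coeff_one]
  | succ k ih =>
    have h : (1 - ((k + 1 : ℕ) : PowerSeries ℤ) * X) * stirlingSeries (k + 1)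
        = stirlingSeries k := by
      ext n
      rw [sub_mul, one_mul, mul_assoc, map_sub, ← nsmul_eq_mul, map_nsmul]
      rcases n with _ | n
      · simp [stirlingSeries, Nat.stirlingSecond_self]
      · rw [coeff_succ_X_mul]
        simp only [stirlingSeries, coeff_mk]
        rw [show n + 1 + (k + 1) = (n + 1 + k) + 1 by ring, Nat.stirlingSecond_succ_succ,
          show n + (k + 1) = n + 1 + k by ring]
        push_cast
        simp
    rw [stirlingDenom, Finset.prod_range_succ, mul_assoc, h]
    exact ih

theorem dvd_stirlingDenom_add_sub (m d : ℕ) :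
    (m : PowerSeries ℤ) ∣ stirlingDenom (m + d) - stirlingDenom m * stirlingDenom d := by
  induction d with
  | zero => simp [stirlingDenom]
  | succ d ih =>
    have h : (m : PowerSeries ℤ) ∣ (1 - ((m + d + 1 : ℕ) : PowerSeries ℤ) * X)
        - (1 - ((d + 1 : ℕ) : PowerSeries ℤ) * X) := ⟨-X, by push_cast; ring⟩
    have := dvd_mul_sub_mul ih h
    rw [← add_assoc, stirlingDenom, Finset.prod_range_succ, stirlingDenom, stirlingDenom,
      Finset.prod_range_succ _ d, ← mul_assoc]
    exact this

theorem dvd_stirlingDenom_mul_add_sub (m b d : ℕ) :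
    (m : PowerSeries ℤ) ∣
      stirlingDenom (m * b + d) - stirlingDenom m ^ b * stirlingDenom d := by
  induction b with
  | zero => simp
  | succ b ih =>
    have h := dvd_stirlingDenom_add_sub m (m * b + d)
    have h2 := ih.mul_left (stirlingDenom m)
    have := dvd_add h h2
    rw [show m * (b + 1) + d = m + (m * b + d) by ring]
    convert this using 1
    ring

theorem prime_pow_succ_dvd_pow_sub_pow {R : Type*} [CommRing R] {p e : ℕ} {x y : R}
    (he : e ≠ 0) (h : (p : R) ^ e ∣ x - y) : (p : R) ^ (e + 1) ∣ x ^ p - y ^ p := by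
  rw [← geom_sum₂_mul, pow_succ']
  exact mul_dvd_mul (dvd_geom_sum₂_self ((dvd_pow_self _ he).trans h)) h

theorem prime_dvd_stirlingDenom_sub (p : ℕ) [hp : Fact p.Prime] :
    (p : PowerSeries ℤ) ∣ stirlingDenom p - (1 - X ^ (p - 1)) := by
  obtain ⟨q, rfl⟩ : ∃ q, p = q + 1 := ⟨p - 1, by have := hp.out.pos; omega⟩
  have hq : q ≠ 0 := by rintro rfl; exact hp.out.ne_one rfl
  let P : Polynomial ℤ :=
    ∏ i ∈ Finset.range (q + 1), (1 - ((i + 1 : ℕ) : Polynomial ℤ) * Polynomial.X)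
  have key : ((q + 1 : ℕ) : Polynomial ℤ) ∣ P - (1 - Polynomial.X ^ q) := by
    have hz : (P - (1 - Polynomial.X ^ q)).map (Int.castRingHom (ZMod (q + 1))) = 0 := by
      rw [Polynomial.map_sub, sub_eq_zero]
      have hP : P.map (Int.castRingHom (ZMod (q + 1)))
          = ∏ i ∈ Finset.range q, (1 - ((i + 1 : ℕ) : Polynomial (ZMod (q + 1))) * Polynomial.X) := by
        simp only [P, Polynomial.map_prod]
        rw [Finset.prod_range_succ]
        have : ((q + 1 : ℕ) : Polynomial (ZMod (q + 1))) = 0 := by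
          rw [← Polynomial.C_eq_natCast, ZMod.natCast_self, Polynomial.C_0]
        simp only [Polynomial.map_sub, Polynomial.map_one, Polynomial.map_mul,
          Polynomial.map_natCast, Polynomial.map_X, this, zero_mul, sub_zero, mul_one]
      rw [hP]
      refine Polynomial.eq_of_natDegree_lt_card_of_eval_eq _ _ (f := id) Function.injective_id ?_ ?_
      · intro x
        simp only [id, Polynomial.eval_prod, Polynomial.map_sub, Polynomial.map_one,
          Polynomial.map_pow, Polynomial.map_X, Polynomial.eval_sub, Polynomial.eval_one,
          Polynomial.eval_pow, Polynomial.eval_X, Polynomial.eval_mul, Polynomial.eval_natCast]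
        by_cases hx : x = 0
        · simp [hx, hq]
        · have h1 : x ^ q = 1 := ZMod.pow_card_sub_one_eq_one hx
          rw [h1, sub_self]
          have hv0 : x⁻¹.val ≠ 0 := by
            rw [Ne, ZMod.val_eq_zero]; exact inv_ne_zero hx
          have hlt := ZMod.val_lt x⁻¹
          refine Finset.prod_eq_zero (i := x⁻¹.val - 1) (Finset.mem_range.2 (by omega)) ?_
          rw [Nat.sub_add_cancel (by omega), ZMod.natCast_zmod_val, inv_mul_cancel₀ hx, sub_self]
      · rw [ZMod.card, Nat.lt_succ_iff, max_le_iff]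
        constructor
        · refine (Polynomial.natDegree_prod_le _ _).trans ?_
          refine (Finset.sum_le_card_nsmul _ _ 1 fun i _ => ?_).trans (by simp)
          rw [← Polynomial.C_eq_natCast]
          compute_degree
        · simp only [Polynomial.map_sub, Polynomial.map_one, Polynomial.map_pow, Polynomial.map_X]
          compute_degree
    rw [← Polynomial.C_eq_natCast, Polynomial.C_dvd_iff_dvd_coeff]
    intro i
    have := congrArg (fun f => f.coeff i) hz
    simp only [Polynomial.coeff_map, Polynomial.coeff_zero, eq_intCast] at this
    exact_mod_cast (ZMod.intCast_zmod_eq_zero_iff_dvd _ (q + 1)).1 this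
  have := map_dvd (Polynomial.coeToPowerSeries.ringHom (R := ℤ)) key
  simp only [P, map_sub, map_prod, map_one, map_mul, map_natCast, map_pow] at this
  simpa only [Polynomial.coeToPowerSeries.ringHom_apply, Polynomial.coe_X, stirlingDenom,
    Nat.add_sub_cancel] using this

theorem prime_pow_dvd_stirlingDenom_sub (p : ℕ) [hp : Fact p.Prime] (e : ℕ) :
    ((p : PowerSeries ℤ) ^ e) ∣ stirlingDenom (p ^ (e + 1)) - (1 - X ^ (p - 1)) ^ p ^ e := by
  have h1 : ((p : PowerSeries ℤ) ^ e) ∣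
      stirlingDenom (p ^ (e + 1)) - stirlingDenom p ^ p ^ e := by
    induction e with
    | zero => simp
    | succ e ih =>
      have h2 := dvd_stirlingDenom_mul_add_sub (p ^ (e + 1)) p 0
      simp only [add_zero, stirlingDenom, Finset.range_zero, Finset.prod_empty, mul_one,
        Nat.cast_pow] at h2
      rw [← pow_succ] at h2
      rcases e with _ | e
      · simpa [stirlingDenom] using h2
      · have h3 := prime_pow_succ_dvd_pow_sub_pow (Nat.succ_ne_zero e) ih
        rw [← pow_mul, ← pow_succ] at h3
        have h4 := dvd_add h2 h3
        simpa [stirlingDenom] using h4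
  have h2 := dvd_sub_pow_of_dvd_sub (prime_dvd_stirlingDenom_sub p) e
  have := dvd_add h1 ((pow_dvd_pow _ (Nat.le_succ e)).trans h2)
  simpa using this

/-- The inverse `∑ X^(q j)` of `1 - X^q`. -/
noncomputable def geomSeriesPow (q : ℕ) : PowerSeries ℤ :=
  PowerSeries.mk fun n => if q ∣ n then 1 else 0

theorem one_sub_X_pow_mul_mk_multichoose {q : ℕ} (hq : 0 < q) (E : ℕ) :
    (1 - X ^ q) * (PowerSeries.mk fun n =>
        if q ∣ n then ((E + 1).multichoose (n / q) : ℤ) else 0)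
      = PowerSeries.mk fun n => if q ∣ n then (E.multichoose (n / q) : ℤ) else 0 := by
  ext n
  rw [sub_mul, one_mul, map_sub, coeff_X_pow_mul']
  simp only [coeff_mk]
  by_cases hn : q ∣ n
  · obtain ⟨j, rfl⟩ := hn
    rcases j with _ | j
    · simp [hq.ne']
    · have h1 : q ≤ q * (j + 1) := Nat.le_mul_of_pos_right _ (Nat.succ_pos j)
      have h2 : q * (j + 1) - q = q * j := by rw [mul_add, mul_one, Nat.add_sub_cancel]
      rw [if_pos h1, h2]
      simp only [dvd_mul_right, if_true, Nat.mul_div_cancel_left _ hq]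
      rw [Nat.multichoose_succ_succ]
      push_cast
      ring
  · rw [if_neg hn, if_neg hn]
    split_ifs with h1 h2
    · exact absurd ((Nat.dvd_sub_iff_left h1 dvd_rfl).1 h2) hn
    · simp
    · simp

theorem one_sub_X_pow_mul_geomSeriesPow {q : ℕ} (hq : 0 < q) :
    (1 - X ^ q) * geomSeriesPow q = 1 := by
  have h := one_sub_X_pow_mul_mk_multichoose hq 0
  convert h using 1
  · simp [geomSeriesPow, Nat.multichoose_one]
  · ext n
    rcases n with _ | n
    · simp
    · simp only [coeff_one, coeff_mk, Nat.succ_ne_zero, if_false]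
      split_ifs with hn
      · have : (n + 1) / q ≠ 0 := (Nat.div_pos (Nat.le_of_dvd n.succ_pos hn) hq).ne'
        obtain ⟨j, hj⟩ := Nat.exists_eq_succ_of_ne_zero this
        simp [hj]
      · rfl

theorem coeff_geomSeriesPow_pow {q : ℕ} (hq : 0 < q) (E n : ℕ) :
    coeff n (geomSeriesPow q ^ E) = if q ∣ n then (E.multichoose (n / q) : ℤ) else 0 := by
  have hQ := one_sub_X_pow_mul_geomSeriesPow hq
  have h : geomSeriesPow q ^ E = PowerSeries.mk fun n =>
      if q ∣ n then (E.multichoose (n / q) : ℤ) else 0 := by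
    induction E with
    | zero =>
      have h0 := one_sub_X_pow_mul_mk_multichoose hq 0
      simp only [zero_add, Nat.multichoose_one, Nat.cast_one] at h0
      rw [pow_zero, ← h0]
      exact hQ.symm
    | succ E ih =>
      rw [pow_succ, ih, ← one_sub_X_pow_mul_mk_multichoose hq E]
      linear_combination (PowerSeries.mk fun n =>
        if q ∣ n then ((E + 1).multichoose (n / q) : ℤ) else 0) * hQ
  rw [h, coeff_mk]

/-- The geometric series `∑ i^n X^n`. -/
noncomputable def geomSeries (i : ℤ) : PowerSeries ℤ := PowerSeries.mk fun n => i ^ n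

theorem one_sub_mul_geomSeries (i : ℤ) : (1 - C i * X) * geomSeries i = 1 := by
  ext n
  rw [sub_mul, one_mul, mul_assoc, map_sub, coeff_C_mul]
  rcases n with _ | n
  · simp [geomSeries]
  · rw [coeff_succ_X_mul]
    simp [geomSeries, coeff_one, pow_succ']

theorem pow_dvd_geomSeries_sub_sum {p : ℕ} {i : ℤ} (hi : (p : ℤ) ∣ i) (L : ℕ) :
    (p : PowerSeries ℤ) ^ L ∣
      geomSeries i - ∑ t ∈ Finset.range L, (C i * X) ^ t := by
  have h : geomSeries i - ∑ t ∈ Finset.range L, (C i * X) ^ t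
      = geomSeries i * (C i * X) ^ L := by
    have h1 := mul_neg_geom_sum (C i * X : PowerSeries ℤ) L
    have h2 := one_sub_mul_geomSeries i
    linear_combination (∑ t ∈ Finset.range L, (C i * X) ^ t) * h2 - geomSeries i * h1
  rw [h]
  have : (p : PowerSeries ℤ) ∣ C i := by
    have := map_dvd (C : ℤ →+* PowerSeries ℤ) hi
    simpa using this
  exact (pow_dvd_pow_of_dvd (this.mul_right X) L).mul_left _

theorem pow_dvd_geomSeries_sub_sum_of_dvd_pow_sub_one {p q : ℕ} (hq : 0 < q) {i : ℤ}
    (hi : (p : ℤ) ∣ i ^ q - 1) (L : ℕ) :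
    (p : PowerSeries ℤ) ^ L ∣
      geomSeries i - (∑ r ∈ Finset.range q, (C i * X) ^ r) * (geomSeriesPow q *
        ∑ l ∈ Finset.range L, (C (i ^ q - 1) * X ^ q * geomSeriesPow q) ^ l) := by
  set Q := geomSeriesPow q
  set v := i ^ q - 1 with hv
  set W := ∑ r ∈ Finset.range q, (C i * X : PowerSeries ℤ) ^ r with hW
  set S := ∑ l ∈ Finset.range L, (C v * X ^ q * Q) ^ l with hS
  have h : geomSeries i - W * (Q * S) = geomSeries i * (C v * X ^ q * Q) ^ L := by
    have h1 := mul_neg_geom_sum (C i * X : PowerSeries ℤ) q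
    have h2 := one_sub_mul_geomSeries i
    have h3 := mul_neg_geom_sum (C v * X ^ q * Q) L
    have h4 : (1 - X ^ q) * Q = 1 := one_sub_X_pow_mul_geomSeriesPow hq
    have h5 : (C v : PowerSeries ℤ) = C i ^ q - 1 := by rw [hv]; simp
    rw [← hW] at h1
    rw [← hS] at h3
    rw [mul_pow] at h1
    linear_combination W * Q * S * h2 - geomSeries i * Q * S * h1 - geomSeries i * h3
      - geomSeries i * S * h4 - geomSeries i * S * Q * X ^ q * h5
  rw [h]
  have : (p : PowerSeries ℤ) ∣ C v := by
    have := map_dvd (C : ℤ →+* PowerSeries ℤ) hi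
    simpa using this
  exact (pow_dvd_pow_of_dvd ((this.mul_right _).mul_right _) L).mul_left _

theorem succ_mul_multichoose_succ (E j : ℕ) :
    (j + 1) * E.multichoose (j + 1) = E * (E + 1).multichoose j := by
  rw [Nat.multichoose_eq, Nat.multichoose_eq]
  have := Nat.choose_succ_right_eq (E + j) j
  rw [show E + (j + 1) - 1 = E + j by omega, show E + 1 + j - 1 = E + j by omega, mul_comm, this,
    Nat.add_sub_cancel, mul_comm]

theorem add_mul_multichoose (E j : ℕ) :
    (E + j) * E.multichoose j = E * (E + 1).multichoose j := by
  rcases j with _ | j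
  · simp
  · rw [add_mul, succ_mul_multichoose_succ, Nat.multichoose_succ_succ, mul_add]

theorem prime_pow_succ_dvd_choose_sub (p : ℕ) [hp : Fact p.Prime] (e A B : ℕ) :
    (p : ℤ) ^ (e + 1) ∣ ((p ^ (e + 1) * A).choose (p ^ (e + 1) * B) : ℤ)
      - ((p ^ e * A).choose (p ^ e * B) : ℤ) := by
  have h1 : (p : Polynomial ℤ) ∣ (1 + Polynomial.X) ^ p - (1 + Polynomial.X ^ p) := by
    obtain ⟨r, hr⟩ := exists_add_pow_prime_eq hp.out (1 : Polynomial ℤ) Polynomial.X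
    exact ⟨Polynomial.X * r, by rw [hr]; ring⟩
  have h2 := (dvd_sub_pow_of_dvd_sub h1 e).trans (sub_dvd_pow_sub_pow _ _ A)
  rw [← pow_mul, ← pow_mul, ← pow_mul, show p * (p ^ e * A) = p ^ (e + 1) * A by ring,
    ← Nat.cast_pow, ← Polynomial.C_eq_natCast,
    Polynomial.C_dvd_iff_dvd_coeff] at h2
  have h3 := h2 (p ^ (e + 1) * B)
  have h4 : (1 + Polynomial.X ^ p : Polynomial ℤ) ^ (p ^ e * A)
      = Polynomial.expand ℤ p ((1 + Polynomial.X) ^ (p ^ e * A)) := by simp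
  rw [Polynomial.coeff_sub, Polynomial.coeff_one_add_X_pow, h4,
    show p ^ (e + 1) * B = p * (p ^ e * B) by ring, Polynomial.coeff_expand_mul' hp.out.pos,
    Polynomial.coeff_one_add_X_pow] at h3
  rw [show p ^ (e + 1) * B = p * (p ^ e * B) by ring]
  simpa using h3

open Filter Topology

/-- Convergence of an integer sequence in `ℚ_[p]`. -/
def PadicConverges (p : ℕ) [Fact p.Prime] (s : ℕ → ℤ) : Prop :=
  ∃ y : ℚ_[p], Tendsto (fun e => (s e : ℚ_[p])) atTop (𝓝 y)

namespace PadicConverges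

variable {p : ℕ} [hp : Fact p.Prime] {s t : ℕ → ℤ}

theorem const (c : ℤ) : PadicConverges p fun _ => c := ⟨c, tendsto_const_nhds⟩

theorem congr (hs : PadicConverges p s) (h : ∀ᶠ e in atTop, s e = t e) : PadicConverges p t := by
  obtain ⟨y, hy⟩ := hs
  exact ⟨y, hy.congr' (h.mono fun e he => by rw [he])⟩

theorem add (hs : PadicConverges p s) (ht : PadicConverges p t) :
    PadicConverges p fun e => s e + t e := by
  obtain ⟨y, hy⟩ := hs
  obtain ⟨z, hz⟩ := ht
  exact ⟨y + z, by simpa using hy.add hz⟩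

theorem mul (hs : PadicConverges p s) (ht : PadicConverges p t) :
    PadicConverges p fun e => s e * t e := by
  obtain ⟨y, hy⟩ := hs
  obtain ⟨z, hz⟩ := ht
  exact ⟨y * z, by simpa using hy.mul hz⟩

theorem sub (hs : PadicConverges p s) (ht : PadicConverges p t) :
    PadicConverges p fun e => s e - t e := by
  simpa [sub_eq_add_neg] using hs.add ((const (-1)).mul ht)

theorem sum {ι : Type*} (I : Finset ι) {f : ι → ℕ → ℤ} (h : ∀ i ∈ I, PadicConverges p (f i)) :
    PadicConverges p fun e => ∑ i ∈ I, f i e := by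
  classical
  induction I using Finset.induction_on with
  | empty => simpa using const (p := p) 0
  | insert i I hi ih =>
    simp only [Finset.sum_insert hi]
    exact (h i (Finset.mem_insert_self i I)).add
      (ih fun j hj => h j (Finset.mem_insert_of_mem hj))

theorem of_mul {c : ℚ_[p]} (hc : c ≠ 0) (ht : Tendsto (fun e => (t e : ℚ_[p])) atTop (𝓝 c))
    (h : PadicConverges p fun e => t e * s e) : PadicConverges p s := by
  obtain ⟨y, hy⟩ := h
  refine ⟨y / c, (hy.div ht hc).congr' ?_⟩
  filter_upwards [ht.eventually_ne hc] with e he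
  rw [Pi.div_apply, Int.cast_mul, mul_div_cancel_left₀ _ he]

theorem mul_of_tendsto_zero (ht : Tendsto (fun e => (t e : ℚ_[p])) atTop (𝓝 0)) (s : ℕ → ℤ) :
    PadicConverges p fun e => t e * s e := by
  refine ⟨0, squeeze_zero_norm (fun e => ?_) (tendsto_norm_zero.comp ht)⟩
  push_cast
  rw [norm_mul]
  exact mul_le_of_le_one_right (norm_nonneg _) (Padic.norm_int_le_one _)

theorem of_approx
    (h : ∀ L : ℕ, ∃ t : ℕ → ℤ, PadicConverges p t ∧ ∀ᶠ e in atTop, (p : ℤ) ^ L ∣ s e - t e) :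
    PadicConverges p s := by
  have hc : CauchySeq fun e => (s e : ℚ_[p]) := by
    rw [Metric.cauchySeq_iff']
    intro ε hε
    obtain ⟨L, hL⟩ := PadicInt.exists_pow_neg_lt p hε
    obtain ⟨t, ⟨y, hy⟩, hst⟩ := h L
    obtain ⟨N₁, hN₁⟩ := Metric.cauchySeq_iff'.1 hy.cauchySeq ε hε
    obtain ⟨N₂, hN₂⟩ := eventually_atTop.1 hst
    obtain ⟨N, hN⟩ := Metric.cauchySeq_iff.1 hy.cauchySeq ε hε
    have hd : ∀ e ≥ N₂, dist (s e : ℚ_[p]) (t e) < ε := fun e he => by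
      rw [dist_eq_norm, ← Int.cast_sub]
      exact ((Padic.norm_int_le_pow_iff_dvd _ _).2 (hN₂ e he)).trans_lt hL
    refine ⟨max N N₂, fun n hn => ?_⟩
    have h1 := hd n (le_of_max_le_right hn)
    have h2 := hd (max N N₂) (le_max_right _ _)
    have h3 := hN n (le_of_max_le_left hn) (max N N₂) (le_max_left _ _)
    rw [dist_comm] at h2
    exact (dist_triangle_max _ (t n : ℚ_[p]) _).trans_lt
      (max_lt h1 ((dist_triangle_max _ (t (max N N₂) : ℚ_[p]) _).trans_lt (max_lt h3 h2)))
  exact cauchySeq_tendsto_of_complete hc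

theorem of_pow_dvd (h : ∀ e, (p : ℤ) ^ (e + 1) ∣ s (e + 1) - s e) : PadicConverges p s := by
  refine of_approx fun L => ⟨fun _ => s L, const _, eventually_atTop.2 ⟨L, fun e he => ?_⟩⟩
  induction e, he using Nat.le_induction with
  | base => simp
  | succ e he ih =>
    have := dvd_add ((pow_dvd_pow (p : ℤ) (by omega : L ≤ e + 1)).trans (h e)) ih
    simpa using this

theorem exists_tendsto_padicInt (hs : PadicConverges p s) :
    ∃ y : ℤ_[p], Tendsto (fun e => (s e : ℤ_[p])) atTop (𝓝 y) := by
  obtain ⟨y, hy⟩ := hs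
  have hy1 : ‖y‖ ≤ 1 := le_of_tendsto' hy.norm fun e => Padic.norm_int_le_one _
  refine ⟨⟨y, hy1⟩, tendsto_subtype_rng.2 ?_⟩
  simpa using hy

end PadicConverges

theorem tendsto_prime_pow_mul_add (p : ℕ) [Fact p.Prime] (A c : ℤ) :
    Tendsto (fun e : ℕ => (((p : ℤ) ^ e * A + c : ℤ) : ℚ_[p])) atTop (𝓝 c) := by
  have h : Tendsto (fun e : ℕ => (p : ℚ_[p]) ^ e) atTop (𝓝 0) :=
    tendsto_pow_atTop_nhds_zero_of_norm_lt_one Padic.norm_p_lt_one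
  simpa using (h.mul_const (A : ℚ_[p])).add_const (c : ℚ_[p])

theorem eventually_le_prime_pow_mul (p : ℕ) [hp : Fact p.Prime] {N : ℕ} (hN : 0 < N) (h : ℕ) :
    ∀ᶠ e : ℕ in atTop, h ≤ p ^ (e + 1) * N := by
  filter_upwards [eventually_ge_atTop h] with e he
  have := (Nat.lt_pow_self (n := e + 1) hp.out.one_lt).le
  nlinarith [Nat.le_mul_of_pos_right (p ^ (e + 1)) hN]

theorem padicConverges_multichoose (p : ℕ) [hp : Fact p.Prime] (b N : ℕ) (hN : 0 < N) (l h : ℕ) :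
    PadicConverges p fun e =>
      ((p ^ e * b + l).multichoose (p ^ (e + 1) * N - h) : ℤ) := by
  have pascal : ∀ l h : ℕ, ∀ᶠ e : ℕ in atTop,
      ((p ^ e * b + (l + 1)).multichoose (p ^ (e + 1) * N - h) : ℤ)
      = (p ^ e * b + l).multichoose (p ^ (e + 1) * N - h)
        + (p ^ e * b + (l + 1)).multichoose (p ^ (e + 1) * N - (h + 1)) := fun l h => by
    filter_upwards [eventually_le_prime_pow_mul p hN (h + 1)] with e he
    obtain ⟨j, hj⟩ := Nat.exists_eq_add_of_le he
    rw [show p ^ (e + 1) * N - h = j + 1 by omega, show p ^ (e + 1) * N - (h + 1) = j by omega,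
      ← add_assoc, Nat.multichoose_succ_succ]
    push_cast
    ring
  have shift : ∀ l h : ℕ, ∀ᶠ e : ℕ in atTop,
      ((p : ℤ) ^ e * (p * N) + (-h : ℤ)) * ((p ^ e * b + l).multichoose (p ^ (e + 1) * N - h) : ℤ)
      = ((p : ℤ) ^ e * b + l)
        * (p ^ e * b + (l + 1)).multichoose (p ^ (e + 1) * N - (h + 1)) := fun l h => by
    filter_upwards [eventually_le_prime_pow_mul p hN (h + 1)] with e he
    obtain ⟨j, hj⟩ := Nat.exists_eq_add_of_le he
    rw [show p ^ (e + 1) * N - h = j + 1 by omega, show p ^ (e + 1) * N - (h + 1) = j by omega,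
      ← add_assoc]
    have h1 := succ_mul_multichoose_succ (p ^ e * b + l) j
    have h2 : (p : ℤ) ^ e * (p * N) + (-h : ℤ) = j + 1 := by
      have : ((p ^ (e + 1) * N : ℕ) : ℤ) = ((h + 1 + j : ℕ) : ℤ) := by rw [hj]
      push_cast at this
      linear_combination this
    rw [h2]
    exact_mod_cast h1
  have base : PadicConverges p fun e =>
      ((p ^ e * b + 1).multichoose (p ^ (e + 1) * N - 0) : ℤ) := by
    have hch : ∀ e, (p ^ e * b + 1).multichoose (p ^ (e + 1) * N - 0)
        = (p ^ e * (b + p * N)).choose (p ^ e * (p * N)) := fun e => by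
      have h1 : p ^ (e + 1) * N = p ^ e * (p * N) := by ring
      rw [Nat.multichoose_eq, Nat.sub_zero, h1, mul_add, add_right_comm, Nat.add_sub_cancel]
    simp only [hch]
    exact PadicConverges.of_pow_dvd fun e => prime_pow_succ_dvd_choose_sub p e (b + p * N) (p * N)
  have zero : ∀ h : ℕ, PadicConverges p fun e =>
      ((p ^ e * b + 0).multichoose (p ^ (e + 1) * N - h) : ℤ) := by
    intro h
    rcases h with _ | h
    · have hne : ((b + p * N : ℕ) : ℚ_[p]) ≠ 0 := by
        have := Nat.mul_pos hp.out.pos hN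
        exact_mod_cast (by omega : b + p * N ≠ 0)
      refine PadicConverges.of_mul (t := fun _ => ((b + p * N : ℕ) : ℤ)) hne
        (by simp) ?_
      refine ((PadicConverges.const b).mul base).congr (Eventually.of_forall fun e => ?_)
      have h1 := add_mul_multichoose (p ^ e * b) (p ^ (e + 1) * N)
      have h2 : (0 : ℤ) < (p : ℤ) ^ e := pow_pos (by exact_mod_cast hp.out.pos) e
      refine mul_left_cancel₀ h2.ne' ?_
      zify at h1
      simp only [add_zero, Nat.sub_zero]
      push_cast
      linear_combination -h1
    · have hne : ((-(h + 1 : ℕ) : ℤ) : ℚ_[p]) ≠ 0 := by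
        exact_mod_cast (by omega : (-(h + 1 : ℕ) : ℤ) ≠ 0)
      refine PadicConverges.of_mul hne (tendsto_prime_pow_mul_add p (p * N) (-(h + 1 : ℕ) : ℤ)) ?_
      have h0 := tendsto_prime_pow_mul_add p b 0
      rw [Int.cast_zero] at h0
      exact (PadicConverges.mul_of_tendsto_zero h0 _).congr
        ((shift 0 (h + 1)).mono fun e he => he.symm)
  induction l generalizing h with
  | zero => exact zero h
  | succ l ih =>
    rcases l with _ | l
    · induction h with
      | zero => exact base
      | succ h ihh =>
        exact (ihh.sub (zero h)).congr ((pascal 0 h).mono fun e he => by rw [he]; ring)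
    · have step : ∀ h : ℕ, PadicConverges p fun e =>
          ((p ^ e * b + (l + 1 + 1)).multichoose (p ^ (e + 1) * N - (h + 1)) : ℤ) := fun h => by
        have hne : (((l + 1 : ℕ) : ℤ) : ℚ_[p]) ≠ 0 := by exact_mod_cast l.succ_ne_zero
        refine PadicConverges.of_mul hne (tendsto_prime_pow_mul_add p b (l + 1 : ℕ)) ?_
        refine PadicConverges.congr
          (PadicConverges.mul ⟨_, tendsto_prime_pow_mul_add p (p * N) (-h : ℤ)⟩ (ih h))
          (shift (l + 1) h)
      rcases h with _ | h
      · exact ((ih 0).add (step 0)).congr ((pascal (l + 1) 0).mono fun e he => he.symm)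
      · exact step h

theorem padicConverges_coeff_geomSeriesPow_pow_mul_X_pow (p : ℕ) [hp : Fact p.Prime] {q : ℕ}
    (hq : 0 < q) (b N : ℕ) (hN : 0 < N) (l t k : ℕ) :
    PadicConverges p fun e =>
      coeff (p ^ (e + 1) * N * q - k) (geomSeriesPow q ^ (p ^ e * b + l) * X ^ t) := by
  have hle := eventually_le_prime_pow_mul p hN (k + t)
  have hn : ∀ {m : ℕ}, k + t ≤ m → k + t ≤ m * q := fun h =>
    h.trans (Nat.le_mul_of_pos_right _ hq)
  by_cases hdvd : q ∣ k + t
  · obtain ⟨h, hh⟩ := hdvd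
    refine (padicConverges_multichoose p b N hN l h).congr (hle.mono fun e he => ?_)
    have he' := hn he
    rw [coeff_mul_X_pow', if_pos (by omega), coeff_geomSeriesPow_pow hq, Nat.sub_sub, hh,
      mul_comm q h, ← Nat.sub_mul, if_pos (dvd_mul_left _ _), Nat.mul_div_cancel _ hq]
  · refine (PadicConverges.const 0).congr (hle.mono fun e he => ?_)
    have he' := hn he
    rw [coeff_mul_X_pow', if_pos (by omega), coeff_geomSeriesPow_pow hq, Nat.sub_sub, if_neg]
    exact fun h => hdvd ((Nat.dvd_sub_iff_right he' (dvd_mul_left _ _)).1 h)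

theorem intCast_pow_dvd_coeff {p L : ℕ} {f : PowerSeries ℤ} (h : (p : PowerSeries ℤ) ^ L ∣ f)
    (n : ℕ) : (p : ℤ) ^ L ∣ coeff n f := by
  obtain ⟨g, rfl⟩ := h
  rw [show (p : PowerSeries ℤ) ^ L = C ((p : ℤ) ^ L) by simp, coeff_C_mul]
  exact dvd_mul_right _ _

theorem padicConverges_coeff_mul_geomSeries (p : ℕ) [hp : Fact p.Prime] (b N : ℕ) (hN : 0 < N)
    (k : ℕ) (i : ℤ) :
    PadicConverges p fun e =>
      coeff (p ^ (e + 1) * N * (p - 1) - k)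
        (geomSeriesPow (p - 1) ^ (p ^ e * b) * geomSeries i) := by
  have hq : 0 < p - 1 := by have := hp.out.two_le; omega
  refine PadicConverges.of_approx fun L => ?_
  by_cases hi : (p : ℤ) ∣ i
  · refine ⟨fun e => coeff (p ^ (e + 1) * N * (p - 1) - k) (geomSeriesPow (p - 1) ^ (p ^ e * b)
      * ∑ t ∈ Finset.range L, (C i * X) ^ t), ?_, Eventually.of_forall fun e => ?_⟩
    · refine (PadicConverges.sum (Finset.range L) fun t _ => (PadicConverges.const (i ^ t)).mul
        (padicConverges_coeff_geomSeriesPow_pow_mul_X_pow p hq b N hN 0 t k)).congr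
        (Eventually.of_forall fun e => ?_)
      rw [Finset.mul_sum, map_sum]
      refine Finset.sum_congr rfl fun t _ => ?_
      rw [← coeff_C_mul, mul_pow, map_pow, add_zero, mul_left_comm]
    · rw [← map_sub, ← mul_sub]
      exact intCast_pow_dvd_coeff ((pow_dvd_geomSeries_sub_sum hi L).mul_left _) _
  · have hv : (p : ℤ) ∣ i ^ (p - 1) - 1 := by
      have hcop : IsCoprime i (p : ℤ) :=
        ((Nat.prime_iff_prime_int.1 hp.out).coprime_iff_not_dvd.2 hi).symm
      exact (Int.ModEq.pow_card_sub_one_eq_one hp.out hcop).symm.dvd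
    set v := i ^ (p - 1) - 1
    refine ⟨fun e => coeff (p ^ (e + 1) * N * (p - 1) - k) (geomSeriesPow (p - 1) ^ (p ^ e * b)
      * ((∑ r ∈ Finset.range (p - 1), (C i * X) ^ r) * (geomSeriesPow (p - 1) *
        ∑ l ∈ Finset.range L, (C v * X ^ (p - 1) * geomSeriesPow (p - 1)) ^ l))), ?_,
      Eventually.of_forall fun e => ?_⟩
    · refine (PadicConverges.sum (Finset.range (p - 1)) fun r _ =>
        PadicConverges.sum (Finset.range L) fun l _ => (PadicConverges.const (i ^ r * v ^ l)).mul
          (padicConverges_coeff_geomSeriesPow_pow_mul_X_pow p hq b N hN (l + 1)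
            (r + (p - 1) * l) k)).congr (Eventually.of_forall fun e => ?_)
      rw [Finset.sum_mul, Finset.mul_sum, map_sum]
      refine Finset.sum_congr rfl fun r _ => ?_
      rw [Finset.mul_sum, Finset.mul_sum, Finset.mul_sum, map_sum]
      refine Finset.sum_congr rfl fun l _ => ?_
      rw [← coeff_C_mul]
      congr 1
      rw [map_mul, map_pow, map_pow]
      ring
    · rw [← map_sub, ← mul_sub]
      exact intCast_pow_dvd_coeff
        ((pow_dvd_geomSeries_sub_sum_of_dvd_pow_sub_one hq hv L).mul_left _) _

theorem C_factorial_mul_stirlingSeries (d : ℕ) :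
    C (d.factorial : ℤ) * stirlingSeries d = ∑ i ∈ Finset.range (d + 1),
      C ((-1 : ℤ) ^ (d - i) * (d.choose i : ℤ) * (i : ℤ) ^ d) * geomSeries i := by
  ext n
  rw [coeff_C_mul, map_sum, stirlingSeries, coeff_mk,
    ← sum_alternating_choose_mul_pow_eq_factorial_mul]
  refine Finset.sum_congr rfl fun i _ => ?_
  rw [coeff_C_mul, geomSeries, coeff_mk]
  ring

theorem prime_pow_dvd_stirlingSeries_sub (p : ℕ) [hp : Fact p.Prime] (e b d : ℕ) :
    (p : PowerSeries ℤ) ^ e ∣ stirlingSeries (p ^ (e + 1) * b + d)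
      - geomSeriesPow (p - 1) ^ (p ^ e * b) * stirlingSeries d := by
  have hq : 0 < p - 1 := by have := hp.out.two_le; omega
  have h1 := dvd_stirlingDenom_mul_add_sub (p ^ (e + 1)) b d
  rw [Nat.cast_pow] at h1
  replace h1 := (pow_dvd_pow _ (Nat.le_succ e)).trans h1
  have h2 := ((prime_pow_dvd_stirlingDenom_sub p e).trans
    (sub_dvd_pow_sub_pow _ _ b)).mul_right (stirlingDenom d)
  rw [← pow_mul] at h2
  have h3 := (dvd_add h1 h2).mul_left (-(stirlingSeries (p ^ (e + 1) * b + d)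
    * (geomSeriesPow (p - 1) ^ (p ^ e * b) * stirlingSeries d)))
  convert h3 using 1
  have e1 := stirlingDenom_mul_stirlingSeries (p ^ (e + 1) * b + d)
  have e2 := stirlingDenom_mul_stirlingSeries d
  have e3 : (1 - X ^ (p - 1) : PowerSeries ℤ) ^ (p ^ e * b)
      * geomSeriesPow (p - 1) ^ (p ^ e * b) = 1 := by
    rw [← mul_pow, one_sub_X_pow_mul_geomSeriesPow hq, one_pow]
  set G := stirlingSeries (p ^ (e + 1) * b + d)
  set Gd := stirlingSeries d
  set Q := geomSeriesPow (p - 1) ^ (p ^ e * b)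
  linear_combination Q * Gd * e1 - G * e3
    - G * (1 - X ^ (p - 1) : PowerSeries ℤ) ^ (p ^ e * b) * Q * e2

theorem padicConverges_coeff_stirlingSeries (p : ℕ) [hp : Fact p.Prime] (b N : ℕ) (hN : 0 < N)
    (k d : ℕ) :
    PadicConverges p fun e =>
      coeff (p ^ (e + 1) * N * (p - 1) - k) (stirlingSeries (p ^ (e + 1) * b + d)) := by
  have hf : ((d.factorial : ℤ) : ℚ_[p]) ≠ 0 := by exact_mod_cast d.factorial_ne_zero
  refine PadicConverges.of_mul (t := fun _ => (d.factorial : ℤ)) hf tendsto_const_nhds ?_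
  refine PadicConverges.of_approx fun L => ⟨fun e => coeff (p ^ (e + 1) * N * (p - 1) - k)
    (geomSeriesPow (p - 1) ^ (p ^ e * b) * (C (d.factorial : ℤ) * stirlingSeries d)), ?_, ?_⟩
  · refine (PadicConverges.sum (Finset.range (d + 1)) fun i _ =>
      (PadicConverges.const ((-1 : ℤ) ^ (d - i) * (d.choose i : ℤ) * (i : ℤ) ^ d)).mul
        (padicConverges_coeff_mul_geomSeries p b N hN k i)).congr
      (Eventually.of_forall fun e => ?_)
    rw [C_factorial_mul_stirlingSeries, Finset.mul_sum, map_sum]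
    refine Finset.sum_congr rfl fun i _ => ?_
    rw [← coeff_C_mul, mul_left_comm]
  · filter_upwards [eventually_ge_atTop L] with e he
    rw [← coeff_C_mul, ← map_sub]
    refine intCast_pow_dvd_coeff ?_ _
    have := ((pow_dvd_pow _ he).trans (prime_pow_dvd_stirlingSeries_sub p e b d)).mul_left
      (C (d.factorial : ℤ))
    convert this using 1
    ring

theorem stirling2_natCast (n k : ℕ) : stirling2 n k = n.stirlingSecond k := by
  rw [stirling2, if_neg (by omega)]
  simp only [Int.toNat_natCast]
  rw [sum_alternating_choose_mul_pow_eq_factorial_mul]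
  exact Int.mul_ediv_cancel_left _ (by exact_mod_cast k.factorial_ne_zero)

theorem stirling2_eq_zero_of_lt {n k : ℤ} (hk : 0 ≤ k) (h : n < k) : stirling2 n k = 0 := by
  obtain ⟨k, rfl⟩ := Int.eq_ofNat_of_zero_le hk
  rcases lt_or_ge n 0 with hn | hn
  · rw [stirling2, if_pos (Or.inl hn)]
  · obtain ⟨n, rfl⟩ := Int.eq_ofNat_of_zero_le hn
    rw [stirling2_natCast, Nat.stirlingSecond_eq_zero_of_lt (by omega), Nat.cast_zero]

theorem stirling2_eq_mul_add {k : ℤ} (hk : 1 ≤ k) (n : ℤ) :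
    stirling2 n k = k * stirling2 (n - 1) k + stirling2 (n - 1) (k - 1) := by
  rcases le_or_gt n 0 with hn | hn
  · rw [stirling2_eq_zero_of_lt (by omega) (by omega),
      stirling2_eq_zero_of_lt (by omega) (by omega),
      stirling2_eq_zero_of_lt (by omega) (by omega), mul_zero, add_zero]
  · obtain ⟨k, rfl⟩ := Int.eq_succ_of_zero_lt (show 0 < k by omega)
    obtain ⟨n, rfl⟩ := Int.eq_succ_of_zero_lt hn
    rw [add_sub_cancel_right, add_sub_cancel_right, stirling2_natCast, ← Nat.cast_succ,
      ← Nat.cast_succ, stirling2_natCast, stirling2_natCast]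
    exact_mod_cast Nat.stirlingSecond_succ_succ n k

theorem exists_tendsto_stirling2 (p : ℕ) [hp : Fact p.Prime] {a b k d : ℤ} (hb : 0 ≤ b)
    (hba : b ≤ a) (hab : Int.ModEq ((p : ℤ) - 1) a b) (hk : 1 ≤ k) (hd : 0 ≤ d) :
    ∃ Y : ℤ_[p], Tendsto (fun e : ℕ =>
      ((stirling2 ((p : ℤ) ^ e * a + d - k) ((p : ℤ) ^ e * b + d) : ℤ) : ℤ_[p]))
      atTop (𝓝 Y) := by
  have hp2 := hp.out.two_le
  rcases hba.eq_or_lt with rfl | hlt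
  · refine ⟨0, tendsto_const_nhds.congr fun e => ?_⟩
    rw [stirling2_eq_zero_of_lt (by positivity) (by omega), Int.cast_zero]
  obtain ⟨b, rfl⟩ := Int.eq_ofNat_of_zero_le hb
  obtain ⟨d, rfl⟩ := Int.eq_ofNat_of_zero_le hd
  obtain ⟨k, rfl⟩ := Int.eq_ofNat_of_zero_le (by omega : 0 ≤ k)
  obtain ⟨m, hm⟩ := hab.symm.dvd
  have hm0 : 0 < m := by
    by_contra! h
    nlinarith [show (2 : ℤ) ≤ p by exact_mod_cast hp2]
  obtain ⟨N, rfl⟩ := Int.eq_ofNat_of_zero_le hm0.le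
  have hN : 0 < N := by exact_mod_cast hm0
  obtain ⟨Y, hY⟩ := (padicConverges_coeff_stirlingSeries p b N hN k d).exists_tendsto_padicInt
  refine ⟨Y, (tendsto_add_atTop_iff_nat 1).1 (hY.congr' ?_)⟩
  filter_upwards [eventually_le_prime_pow_mul p hN k] with e he
  have he' : k ≤ p ^ (e + 1) * N * (p - 1) :=
    he.trans (Nat.le_mul_of_pos_right _ (by omega))
  have h1 : (p : ℤ) ^ (e + 1) * a + (d : ℕ) - (k : ℕ)
      = ((p ^ (e + 1) * N * (p - 1) - k + (p ^ (e + 1) * b + d) : ℕ) : ℤ) := by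
    push_cast [Nat.cast_sub he', Nat.cast_sub (show 1 ≤ p by omega)]
    linear_combination (p : ℤ) ^ (e + 1) * hm
  have h2 : (p : ℤ) ^ (e + 1) * (b : ℕ) + (d : ℕ) = ((p ^ (e + 1) * b + d : ℕ) : ℤ) := by
    push_cast; ring
  rw [h1, h2, stirling2_natCast, stirlingSeries, coeff_mk]

theorem padic_limit_stirling2_backwards_recursion (p : ℕ) [Fact p.Prime] (a b k d : ℤ)
    (hb : 0 ≤ b) (hba : b ≤ a) (hab : Int.ModEq ((p : ℤ) - 1) a b)
    (hk : 2 ≤ k) (hd : 1 ≤ d) :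
    ∃ Y1 Y2 Y3 : ℤ_[p],
      Filter.Tendsto
        (fun e : ℕ =>
          ((stirling2 ((p : ℤ) ^ e * a + d - k) ((p : ℤ) ^ e * b + d) : ℤ) : ℤ_[p]))
        Filter.atTop (nhds Y1) ∧
      Filter.Tendsto
        (fun e : ℕ =>
          ((stirling2 ((p : ℤ) ^ e * a + d - (k - 1)) ((p : ℤ) ^ e * b + d) : ℤ) : ℤ_[p]))
        Filter.atTop (nhds Y2) ∧
      Filter.Tendsto
        (fun e : ℕ =>
          ((stirling2 ((p : ℤ) ^ e * a + (d - 1) - (k - 1)) ((p : ℤ) ^ e * b + (d - 1)) : ℤ) :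
            ℤ_[p]))
        Filter.atTop (nhds Y3) ∧
      ((d : ℤ) : ℤ_[p]) * Y1 = Y2 - Y3 := by
  obtain ⟨Y1, h1⟩ := exists_tendsto_stirling2 p hb hba hab (by omega : 1 ≤ k) (by omega : 0 ≤ d)
  obtain ⟨Y2, h2⟩ := exists_tendsto_stirling2 p hb hba hab (by omega : 1 ≤ k - 1) (by omega : 0 ≤ d)
  obtain ⟨Y3, h3⟩ := exists_tendsto_stirling2 p hb hba hab (by omega : 1 ≤ k - 1)
    (by omega : 0 ≤ d - 1)
  refine ⟨Y1, Y2, Y3, h1, h2, h3, ?_⟩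
  have hK : Tendsto (fun e : ℕ => (((p : ℤ) ^ e * b + d : ℤ) : ℤ_[p])) atTop (𝓝 (d : ℤ_[p])) := by
    have h : Tendsto (fun e : ℕ => (p : ℤ_[p]) ^ e) atTop (𝓝 0) :=
      tendsto_pow_atTop_nhds_zero_of_norm_lt_one <| by
        rw [PadicInt.norm_p]; exact inv_lt_one_of_one_lt₀ (by exact_mod_cast (Fact.out : p.Prime).one_lt)
    simpa using (h.mul_const (b : ℤ_[p])).add_const (d : ℤ_[p])
  have hpos : ∀ e : ℕ, 0 ≤ (p : ℤ) ^ e * b := fun e => by positivity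
  refine tendsto_nhds_unique (hK.mul h1) ((h2.sub h3).congr' ?_)
  refine Eventually.of_forall fun e => ?_
  have h := stirling2_eq_mul_add (by linarith [hpos e] : 1 ≤ (p : ℤ) ^ e * b + d)
    ((p : ℤ) ^ e * a + d - (k - 1))
  rw [show (p : ℤ) ^ e * a + d - (k - 1) - 1 = (p : ℤ) ^ e * a + d - k by ring] at h
  beta_reduce
  rw [h, show (p : ℤ) ^ e * a + (d - 1) - (k - 1) = (p : ℤ) ^ e * a + d - k by ring,
    ← add_sub_assoc]
  push_cast
  ring
end

section
/- Let p be a prime, a, b integers with 0 ≤ b ≤ a, and d ≥ 1 an integer. Then the sequence e ↦ S(p^{e+1}·a − (a−b), p^{e+1}·b + d), viewed in ℤ_p, converges as e → ∞. -/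
open Finset PowerSeries

namespace PadicStirling

theorem sum_neg_one_pow_mul_choose_mul_pow (n k : ℕ) :
    ∑ i ∈ range (k + 1), (-1 : ℤ) ^ (k - i) * (k.choose i : ℤ) * (i : ℤ) ^ n =
      (k.factorial : ℤ) * (Nat.stirlingSecond n k : ℤ) := by
  induction n generalizing k with
  | zero =>
    have h := add_pow (1 : ℤ) (-1) k
    simp only [one_pow, one_mul, add_neg_cancel] at h
    simp only [pow_zero, mul_one, ← h]
    rcases k with _ | k <;> simp
  | succ n ih =>
    rcases k with _ | k
    · simp
    rw [Nat.stirlingSecond_succ_succ, Nat.factorial_succ]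
    have h₁ := ih (k + 1)
    have h₂ := ih k
    have key : ∑ i ∈ range (k + 1 + 1), (-1 : ℤ) ^ (k + 1 - i) * ((k + 1).choose i : ℤ) *
          (i : ℤ) ^ (n + 1) =
        (k + 1) * (∑ i ∈ range (k + 1 + 1), (-1 : ℤ) ^ (k + 1 - i) * ((k + 1).choose i : ℤ) *
          (i : ℤ) ^ n + ∑ i ∈ range (k + 1), (-1 : ℤ) ^ (k - i) * (k.choose i : ℤ) *
          (i : ℤ) ^ n) := by
      have hext : ∑ i ∈ range (k + 1), (-1 : ℤ) ^ (k - i) * (k.choose i : ℤ) * (i : ℤ) ^ n =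
          ∑ i ∈ range (k + 1 + 1), -((-1 : ℤ) ^ (k + 1 - i)) * (k.choose i : ℤ) *
            (i : ℤ) ^ n := by
        rw [sum_range_succ _ (k + 1)]
        simp only [Nat.choose_succ_self, Nat.cast_zero, mul_zero, zero_mul, add_zero]
        refine sum_congr rfl fun i hi => ?_
        rw [Nat.sub_add_comm (Nat.lt_succ_iff.1 (mem_range.1 hi)), pow_succ]
        ring
      rw [hext, ← sum_add_distrib, mul_sum]
      refine sum_congr rfl fun i _ => ?_
      have hc : (i : ℤ) * ((k + 1).choose i : ℤ) =
          (k + 1) * (((k + 1).choose i : ℤ) - (k.choose i : ℤ)) := by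
        rcases i with _ | i
        · simp
        · have h := Nat.add_one_mul_choose_eq k i
          have h' := Nat.choose_succ_succ k i
          zify at h h'
          rw [Nat.succ_eq_add_one, Nat.succ_eq_add_one] at h'
          push_cast
          linear_combination -h - ((k : ℤ) + 1) * h'
      linear_combination (-1 : ℤ) ^ (k + 1 - i) * (i : ℤ) ^ n * hc
    rw [key, h₁, h₂, Nat.factorial_succ]
    push_cast
    ring

theorem stirling2_natCast (n k : ℕ) : stirling2 n k = Nat.stirlingSecond n k := by
  have hn : ¬((n : ℤ) < 0 ∨ (k : ℤ) < 0) := by omega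
  rw [stirling2, if_neg hn]
  simp only [Int.toNat_natCast]
  rw [sum_neg_one_pow_mul_choose_mul_pow]
  exact Int.mul_ediv_cancel_left _ (by exact_mod_cast k.factorial_ne_zero)

/-- The product `∏_{i=1}^k (1 - i x)`. -/
def revRisingProd {R : Type*} [CommRing R] (x : R) (k : ℕ) : R :=
  ∏ i ∈ range k, (1 - ((i : R) + 1) * x)

section revRisingProd

variable {R : Type*} [CommRing R] (x : R)

theorem dvd_revRisingProd_add_sub {N n : ℕ} (h : N ∣ n) (m : ℕ) :
    (N : R) ∣ revRisingProd x (n + m) - revRisingProd x n * revRisingProd x m := by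
  obtain ⟨c, rfl⟩ := h
  have hcongr : ∀ m : ℕ, (N : R) ∣ ∏ i ∈ range m, (1 - (((N * c + i : ℕ) : R) + 1) * x) -
      ∏ i ∈ range m, (1 - ((i : R) + 1) * x) := by
    intro m
    induction m with
    | zero => simp
    | succ m ih =>
      obtain ⟨y, hy⟩ := ih
      rw [prod_range_succ, prod_range_succ, eq_add_of_sub_eq hy]
      refine ⟨y * (1 - (((N * c + m : ℕ) : R) + 1) * x) -
        c * x * ∏ i ∈ range m, (1 - ((i : R) + 1) * x), ?_⟩
      push_cast
      ring
  rw [revRisingProd, prod_range_add, revRisingProd, revRisingProd, ← mul_sub]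
  exact (hcongr m).mul_left _

theorem dvd_revRisingProd_mul_sub (N t : ℕ) :
    (N : R) ∣ revRisingProd x (N * t) - revRisingProd x N ^ t := by
  induction t with
  | zero => simp [revRisingProd]
  | succ t ih =>
    have h := dvd_revRisingProd_add_sub x (dvd_mul_right N t) N
    rw [mul_add_one, pow_succ]
    have h' := dvd_add h (ih.mul_right (revRisingProd x N))
    convert h' using 1
    ring

theorem pow_succ_dvd_pow_sub_pow {p k : ℕ} {a b : R} (hk : 1 ≤ k)
    (h : (p : R) ^ k ∣ a - b) : (p : R) ^ (k + 1) ∣ a ^ p - b ^ p := by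
  have hp : (p : R) ∣ ∑ i ∈ range p, a ^ i * b ^ (p - 1 - i) := by
    have hab : (p : R) ∣ a - b := (dvd_pow_self _ (by omega)).trans h
    have h₁ : ∀ i ∈ range p, (p : R) ∣ a ^ i * b ^ (p - 1 - i) - b ^ (p - 1) := by
      intro i hi
      have : b ^ (p - 1) = b ^ i * b ^ (p - 1 - i) := by
        rw [← pow_add]; congr 1; have := mem_range.1 hi; omega
      rw [this, ← sub_mul]
      exact (hab.trans (sub_dvd_pow_sub_pow a b i)).mul_right _
    have h₂ := dvd_sum h₁
    rw [sum_sub_distrib, sum_const, card_range, nsmul_eq_mul] at h₂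
    exact (dvd_sub_left (dvd_mul_right _ _)).1 h₂
  rw [← geom_sum₂_mul, pow_succ']
  exact mul_dvd_mul hp h

end revRisingProd

theorem zmod_revRisingProd_X (p : ℕ) [Fact p.Prime] :
    revRisingProd (Polynomial.X : Polynomial (ZMod p)) p = 1 - Polynomial.X ^ (p - 1) := by
  have hp := (Fact.out : p.Prime)
  have hlast : revRisingProd (Polynomial.X : Polynomial (ZMod p)) p =
      revRisingProd Polynomial.X (p - 1) := by
    have hsucc : ∀ k, revRisingProd (Polynomial.X : Polynomial (ZMod p)) (k + 1) =
        revRisingProd Polynomial.X k * (1 - ((k : Polynomial (ZMod p)) + 1) * Polynomial.X) :=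
      fun k => prod_range_succ _ k
    have hk := hsucc (p - 1)
    rw [Nat.sub_add_cancel hp.one_le] at hk
    rw [hk]
    have : ((p - 1 : ℕ) : Polynomial (ZMod p)) + 1 = 0 := by
      have h : ((p - 1 + 1 : ℕ) : Polynomial (ZMod p)) = 0 := by
        rw [Nat.sub_add_cancel hp.one_le]; exact CharP.cast_eq_zero _ p
      simpa using h
    rw [this]; simp
  rw [hlast]
  refine Polynomial.eq_of_degrees_lt_of_eval_finset_eq (univ : Finset (ZMod p)) ?_ ?_ ?_
  · rw [card_univ, ZMod.card]
    refine lt_of_le_of_lt (b := ((p - 1 : ℕ) : WithBot ℕ)) ?_ (by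
      exact_mod_cast Nat.sub_lt hp.pos one_pos)
    rw [revRisingProd]
    refine (Polynomial.degree_prod_le _ _).trans ?_
    refine (sum_le_sum (g := fun _ => (1 : WithBot ℕ)) fun i _ => ?_).trans (by simp)
    compute_degree
  · rw [card_univ, ZMod.card]
    refine lt_of_le_of_lt (b := ((p - 1 : ℕ) : WithBot ℕ)) ?_ (by
      exact_mod_cast Nat.sub_lt hp.pos one_pos)
    compute_degree
    exact le_rfl
  · intro y _
    have hev : (revRisingProd (Polynomial.X : Polynomial (ZMod p)) (p - 1)).eval y =
        revRisingProd y (p - 1) := by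
      simp [revRisingProd, Polynomial.eval_prod]
    rw [hev]
    simp only [Polynomial.eval_sub, Polynomial.eval_one, Polynomial.eval_pow, Polynomial.eval_X]
    by_cases hy : y = 0
    · subst hy
      have : p - 1 ≠ 0 := by have := hp.two_le; omega
      simp [revRisingProd, this]
    · rw [ZMod.pow_card_sub_one_eq_one hy, sub_self, revRisingProd]
      have hv : (y⁻¹).val ≠ 0 := by
        rw [Ne, ZMod.val_eq_zero]; exact inv_ne_zero hy
      have hlt := ZMod.val_lt (y⁻¹)
      refine prod_eq_zero (i := (y⁻¹).val - 1) (mem_range.2 (by omega)) ?_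
      have : (((y⁻¹).val - 1 : ℕ) : ZMod p) + 1 = y⁻¹ := by
        rw [← Nat.cast_add_one, Nat.sub_add_cancel (by omega), ZMod.natCast_zmod_val]
      rw [this, inv_mul_cancel₀ hy, sub_self]

theorem prime_dvd_revRisingProd_sub (p : ℕ) [Fact p.Prime] :
    (p : ℤ⟦X⟧) ∣ revRisingProd (X : ℤ⟦X⟧) p - (1 - X ^ (p - 1)) := by
  have h : (Polynomial.C (p : ℤ)) ∣
      revRisingProd (Polynomial.X : Polynomial ℤ) p - (1 - Polynomial.X ^ (p - 1)) := by
    rw [Polynomial.C_dvd_iff_dvd_coeff]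
    intro i
    rw [← ZMod.intCast_zmod_eq_zero_iff_dvd, ← eq_intCast (Int.castRingHom (ZMod p)),
      ← Polynomial.coeff_map]
    have : Polynomial.map (Int.castRingHom (ZMod p)) (revRisingProd Polynomial.X p) =
        revRisingProd Polynomial.X p := by
      simp [revRisingProd, Polynomial.map_prod]
    rw [Polynomial.map_sub, this, zmod_revRisingProd_X]
    simp
  have h' := map_dvd (Polynomial.coeToPowerSeries.ringHom (R := ℤ)) h
  simp only [revRisingProd, map_sub, map_prod, map_one, map_mul, map_add, map_natCast,
    map_pow] at h'
  simpa [revRisingProd] using h'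

theorem prime_pow_dvd_revRisingProd_pow_sub (p : ℕ) [Fact p.Prime] (e : ℕ) :
    (p : ℤ⟦X⟧) ^ (e + 1) ∣
      revRisingProd X (p ^ (e + 1)) ^ p - (1 - X ^ (p - 1)) ^ p ^ (e + 1) := by
  induction e with
  | zero =>
    simpa using (prime_dvd_revRisingProd_sub p).trans (sub_dvd_pow_sub_pow _ _ p)
  | succ e ih =>
    have h := dvd_revRisingProd_mul_sub (X : ℤ⟦X⟧) (p ^ (e + 1)) p
    rw [← pow_succ, Nat.cast_pow] at h
    have h' := dvd_add h ih
    rw [sub_add_sub_cancel] at h'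
    have := pow_succ_dvd_pow_sub_pow (by omega) h'
    rwa [← pow_mul, ← pow_succ] at this

theorem prime_pow_dvd_revRisingProd_sub (p : ℕ) [Fact p.Prime] (e : ℕ) :
    (p : ℤ⟦X⟧) ^ e ∣ revRisingProd X (p ^ (e + 1)) - (1 - X ^ (p - 1)) ^ p ^ e := by
  rcases e with _ | e
  · simp
  · have h := dvd_revRisingProd_mul_sub (X : ℤ⟦X⟧) (p ^ (e + 1)) p
    rw [← pow_succ, Nat.cast_pow] at h
    simpa using dvd_add h (prime_pow_dvd_revRisingProd_pow_sub p e)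

theorem prime_dvd_one_sub_pow_sub {R : Type*} [CommRing R] {p : ℕ} (hp : p.Prime) (y : R) :
    (p : R) ∣ (1 - y) ^ p - (1 - y ^ p) := by
  obtain ⟨r, hr⟩ := exists_add_pow_prime_eq hp (1 - y) y
  rw [sub_add_cancel, one_pow] at hr
  exact ⟨-((1 - y) * y * r), by linear_combination -hr⟩

theorem prime_pow_dvd_revRisingProd_succ_sub (p : ℕ) [Fact p.Prime] (e : ℕ) :
    (p : ℤ⟦X⟧) ^ e ∣ revRisingProd X (p ^ (e + 2)) - (1 - X ^ ((p - 1) * p)) ^ p ^ e := by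
  have h₁ := (pow_dvd_pow _ (Nat.le_succ e)).trans (prime_pow_dvd_revRisingProd_sub p (e + 1))
  have h₂ := (pow_dvd_pow _ (Nat.le_succ e)).trans (dvd_sub_pow_of_dvd_sub
    (prime_dvd_one_sub_pow_sub (Fact.out : p.Prime) (X ^ (p - 1) : ℤ⟦X⟧)) e)
  rw [← pow_mul, ← pow_mul, ← pow_succ'] at h₂
  simpa using dvd_add h₁ h₂

/-- The generating function of `n ↦ S(n, k)`. -/
noncomputable def stirlingSeries (k : ℕ) : ℤ⟦X⟧ :=
  PowerSeries.mk fun n => (Nat.stirlingSecond n k : ℤ)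

theorem stirlingSeries_mul_revRisingProd (k : ℕ) :
    stirlingSeries k * revRisingProd X k = X ^ k := by
  induction k with
  | zero =>
    ext n
    rcases n with _ | n <;> simp [stirlingSeries, revRisingProd, coeff_one]
  | succ k ih =>
    have h : stirlingSeries (k + 1) * (1 - ((k : ℤ⟦X⟧) + 1) * X) = X * stirlingSeries k := by
      have hc : ((k : ℤ⟦X⟧) + 1) = C ((k : ℤ) + 1) := by simp
      rw [hc]
      have : stirlingSeries (k + 1) * (1 - C ((k : ℤ) + 1) * X) =
        stirlingSeries (k + 1) - C ((k : ℤ) + 1) * (stirlingSeries (k + 1) * X) := by ring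
      rw [this]
      ext n
      rcases n with _ | n
      · simp [stirlingSeries]
      · rw [map_sub, coeff_C_mul, coeff_succ_mul_X, coeff_succ_X_mul]
        simp only [stirlingSeries, coeff_mk, Nat.stirlingSecond_succ_succ]
        push_cast
        ring
    rw [revRisingProd, prod_range_succ, ← revRisingProd, mul_left_comm, h, mul_left_comm,
      mul_comm (revRisingProd _ _), ih, pow_succ']

theorem isUnit_revRisingProd_X (k : ℕ) : IsUnit (revRisingProd (X : ℤ⟦X⟧) k) := by
  rw [isUnit_iff_constantCoeff]
  simp [revRisingProd, map_prod]

theorem natCast_dvd_coeff {N : ℕ} {φ : ℤ⟦X⟧} (h : (N : ℤ⟦X⟧) ∣ φ) (n : ℕ) :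
    (N : ℤ) ∣ coeff n φ := by
  obtain ⟨ψ, rfl⟩ := h
  rw [← map_natCast (C (R := ℤ)), coeff_C_mul]
  exact dvd_mul_right (N : ℤ) _

theorem coeff_expand_mul_eq_sum {r : ℕ} (hr : r ≠ 0) (W G : ℤ⟦X⟧) {A J : ℕ} (hJ : A < J) :
    coeff A (expand r hr W * G) =
      ∑ j ∈ range J, coeff j W * if r * j ≤ A then coeff (A - r * j) G else 0 := by
  rw [coeff_mul, Nat.sum_antidiagonal_eq_sum_range_succ
    (fun i k => coeff i (expand r hr W) * coeff k G)]
  symm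
  simp only [mul_ite, mul_zero]
  rw [← sum_filter]
  refine sum_of_injOn (fun j => r * j) ?_ ?_ ?_ ?_
  · intro x _ y _ h
    exact Nat.eq_of_mul_eq_mul_left (Nat.pos_of_ne_zero hr) h
  · intro j hj
    simp only [coe_filter, mem_range, Set.mem_ofPred_eq] at hj
    simp only [coe_range, Set.mem_Iio]
    omega
  · intro i hi hni
    rw [coeff_expand_of_not_dvd, zero_mul]
    rintro ⟨j, rfl⟩
    refine hni ⟨j, ?_, rfl⟩
    have h₁ : r * j ≤ A := Nat.lt_succ_iff.1 (mem_range.1 hi)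
    have h₂ : j ≤ r * j := Nat.le_mul_of_pos_left _ (Nat.pos_of_ne_zero hr)
    simp only [coe_filter, mem_range, Set.mem_ofPred_eq]
    omega
  · intro j _
    rw [coeff_expand_mul]

theorem natCast_dvd_mul_coeff_invOneSubPow (N j : ℕ) :
    (N : ℤ) ∣ j * coeff j (invOneSubPow ℤ N).val := by
  rcases N with _ | n
  · rcases j with _ | j <;> simp [invOneSubPow_zero, coeff_one]
  · rcases j with _ | j
    · simp
    rw [invOneSubPow_val_succ_eq_mk_add_choose, coeff_mk]
    have h := Nat.choose_succ_right_eq (n + (j + 1)) n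
    rw [Nat.add_sub_cancel_left] at h
    exact ⟨((n + (j + 1)).choose (n + 1) : ℕ), by zify at h; push_cast; linear_combination -h⟩

theorem dvd_stirlingSecond_sub_sum {q N b d r Q : ℕ} (hr : r ≠ 0) (hNQ : N ∣ Q)
    (h : (N : ℤ⟦X⟧) ∣ revRisingProd X Q - (1 - X ^ r) ^ q) {A J : ℕ} (hJ : A < J) :
    (N : ℤ) ∣ (Nat.stirlingSecond (A + Q * b) (Q * b + d) : ℤ) -
      ∑ j ∈ range J, coeff j (invOneSubPow ℤ (q * b)).val *
        if r * j ≤ A then (Nat.stirlingSecond (A - r * j) d : ℤ) else 0 := by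
  set W := expand r hr (invOneSubPow ℤ (q * b)).val with hW
  have hWH : W * ((1 - X ^ r) ^ q) ^ b = 1 := by
    have h₁ := congrArg (expand r hr) (invOneSubPow ℤ (q * b)).val_inv
    rw [invOneSubPow_inv_eq_one_sub_pow, map_mul, map_pow, map_sub, map_one, expand_X,
      pow_mul] at h₁
    exact h₁
  obtain ⟨u, hu⟩ := isUnit_revRisingProd_X (Q * b + d)
  set Y : ℤ⟦X⟧ := X ^ d * u⁻¹.val with hYdef
  have hY : Y * revRisingProd X (Q * b + d) = X ^ d := by
    rw [← hu, hYdef, mul_assoc, Units.inv_mul, mul_one]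
  have hS : stirlingSeries (Q * b + d) = X ^ (Q * b) * Y := by
    have h₁ := stirlingSeries_mul_revRisingProd (Q * b + d)
    rw [pow_add, ← hY, ← mul_assoc] at h₁
    exact (isUnit_revRisingProd_X _).mul_right_cancel h₁
  have hP : (N : ℤ⟦X⟧) ∣ revRisingProd X (Q * b + d) -
      ((1 - X ^ r) ^ q) ^ b * revRisingProd X d := by
    have hNQ' : (N : ℤ⟦X⟧) ∣ Q := map_dvd (Nat.castRingHom ℤ⟦X⟧) hNQ
    have h₁ := dvd_revRisingProd_add_sub (X : ℤ⟦X⟧) (hNQ.mul_right b) d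
    have h₂ := hNQ'.trans (dvd_revRisingProd_mul_sub (X : ℤ⟦X⟧) Q b)
    have h₃ := h.trans (sub_dvd_pow_sub_pow _ _ b)
    convert dvd_add h₁ ((dvd_add h₂ h₃).mul_right (revRisingProd X d)) using 1
    ring
  have hdiff : (N : ℤ⟦X⟧) ∣ Y - W * stirlingSeries d := by
    rw [← (isUnit_revRisingProd_X (Q * b + d)).dvd_mul_right]
    have : (Y - W * stirlingSeries d) * revRisingProd X (Q * b + d) =
        -(W * stirlingSeries d * (revRisingProd X (Q * b + d) -
          ((1 - X ^ r) ^ q) ^ b * revRisingProd X d)) := by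
      linear_combination hY - stirlingSeries_mul_revRisingProd d -
        stirlingSeries d * revRisingProd X d * hWH
    rw [this]
    exact (hP.mul_left _).neg_right
  have h₁ := natCast_dvd_coeff hdiff A
  rw [map_sub, hW, coeff_expand_mul_eq_sum hr _ _ hJ] at h₁
  have h₂ : coeff A Y = (Nat.stirlingSecond (A + Q * b) (Q * b + d) : ℤ) := by
    rw [← coeff_X_pow_mul Y (Q * b) A, ← hS, stirlingSeries, coeff_mk]
  rw [h₂] at h₁
  simpa only [stirlingSeries, coeff_mk] using h₁

theorem prime_pow_dvd_mul_pow_sub_pow {p : ℕ} [Fact p.Prime] {t M m : ℕ} (hm : m ≤ M)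
    (h : p ^ t ∣ M) (i : ℤ) :
    (p : ℤ) ^ t ∣ (p : ℤ) ^ m * (i ^ (p * M - m) - i ^ (M - m)) := by
  have hp := (Fact.out : p.Prime)
  have hpM : M ≤ p * M := Nat.le_mul_of_pos_left _ hp.pos
  by_cases hi : (p : ℤ) ∣ i
  · rcases Nat.eq_zero_or_pos M with rfl | hM
    · simp
    have htM : t ≤ M := (Nat.lt_pow_self hp.one_lt).le.trans (Nat.le_of_dvd hM h)
    have h₁ : (p : ℤ) ^ (M - m) ∣ i ^ (p * M - m) :=
      (pow_dvd_pow _ (by omega)).trans (pow_dvd_pow_of_dvd hi _)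
    have h₂ : (p : ℤ) ^ (M - m) ∣ i ^ (M - m) := pow_dvd_pow_of_dvd hi _
    refine (pow_dvd_pow _ (by omega : t ≤ m + (M - m))).trans ?_
    rw [pow_add]
    exact mul_dvd_mul_left _ (dvd_sub h₁ h₂)
  · have hco : IsCoprime ((p : ℤ) ^ t) (i ^ m) :=
      ((Nat.prime_iff_prime_int.1 hp).irreducible.coprime_iff_not_dvd.2 hi).pow
    refine Dvd.dvd.mul_left (hco.dvd_of_dvd_mul_left ?_) _
    rw [mul_sub, ← pow_add, ← pow_add, Nat.add_sub_cancel' hm, Nat.add_sub_cancel' (hm.trans hpM)]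
    obtain ⟨c, rfl⟩ := h
    have hfermat : (p : ℤ) ∣ i ^ p - i := by
      rw [← ZMod.intCast_zmod_eq_zero_iff_dvd]
      simp
    have h₁ := (pow_dvd_pow _ (Nat.le_succ t)).trans (dvd_sub_pow_of_dvd_sub hfermat t)
    have h₂ := h₁.trans (sub_dvd_pow_sub_pow _ _ c)
    rwa [← pow_mul, ← pow_mul, ← pow_mul] at h₂

theorem prime_pow_dvd_factorial_mul_stirlingSecond_sub {p : ℕ} [Fact p.Prime] {t M m : ℕ}
    (hm : m ≤ M) (h : p ^ t ∣ M) (d : ℕ) :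
    (p : ℤ) ^ t ∣ (p : ℤ) ^ m * d.factorial *
      ((Nat.stirlingSecond (p * M - m) d : ℤ) - Nat.stirlingSecond (M - m) d) := by
  rw [mul_assoc, mul_sub, ← sum_neg_one_pow_mul_choose_mul_pow,
    ← sum_neg_one_pow_mul_choose_mul_pow, ← sum_sub_distrib, mul_sum]
  refine dvd_sum fun i _ => ?_
  convert (prime_pow_dvd_mul_pow_sub_pow hm h (i : ℤ)).mul_left
    ((-1 : ℤ) ^ (d - i) * (d.choose i : ℤ)) using 1
  ring

theorem prime_pow_dvd_ite_stirlingSecond_sub {p : ℕ} [Fact p.Prime] {t T m A A' B : ℕ}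
    (hA : A + m = T) (hA' : A' + m = p * T) (hT : p ^ t ∣ T) (hB : p ^ t ∣ B) (d : ℕ) :
    (p : ℤ) ^ t ∣ (p : ℤ) ^ m * d.factorial *
      ((if p * B ≤ A' then (Nat.stirlingSecond (A' - p * B) d : ℤ) else 0) -
        if B ≤ A then (Nat.stirlingSecond (A - B) d : ℤ) else 0) := by
  have hp := (Fact.out : p.Prime)
  have hdvd : p ^ t ∣ T - B := Nat.dvd_sub hT hB
  have hmul : p * (T - B) = p * T - p * B := Nat.mul_sub p T B
  by_cases h : B ≤ A
  · have h₁ : T - B ≤ p * (T - B) := Nat.le_mul_of_pos_left _ hp.pos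
    have h₀ : p * B ≤ p * T := Nat.mul_le_mul_left _ (by omega)
    rw [if_pos h, if_pos (by omega)]
    have h₂ := prime_pow_dvd_factorial_mul_stirlingSecond_sub (m := m) (by omega) hdvd d
    rwa [show p * (T - B) - m = A' - p * B by omega, show T - B - m = A - B by omega] at h₂
  · by_cases h' : p * B ≤ A'
    · have hle : B ≤ T := Nat.le_of_mul_le_mul_left (h'.trans (by omega)) hp.pos
      have hTB : B < T := by
        by_contra hge
        have : p * T ≤ p * B := Nat.mul_le_mul_left _ (by omega)
        omega
      have h₁ : p ^ t ≤ T - B := Nat.le_of_dvd (by omega) hdvd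
      have h₂ : t < p ^ t := Nat.lt_pow_self hp.one_lt
      rw [mul_assoc]
      exact (pow_dvd_pow _ (by omega)).mul_right _
    · simp [h, h']

theorem prime_pow_dvd_stirlingSecond_succ_sub (p : ℕ) [Fact p.Prime] (b d m e A A' : ℕ)
    (hA : A + m = p ^ (e + 1) * m) (hA' : A' + m = p ^ (e + 2) * m) :
    (p : ℤ) ^ e ∣ (p : ℤ) ^ m * d.factorial *
      ((Nat.stirlingSecond (A' + p ^ (e + 2) * b) (p ^ (e + 2) * b + d) : ℤ) -
        Nat.stirlingSecond (A + p ^ (e + 1) * b) (p ^ (e + 1) * b + d)) := by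
  have hp := (Fact.out : p.Prime)
  have hr : p - 1 ≠ 0 := by have := hp.two_le; omega
  have hAA' : A ≤ A' := by
    have : p ^ (e + 1) * m ≤ p ^ (e + 2) * m :=
      Nat.mul_le_mul_right _ (Nat.pow_le_pow_right hp.pos (by omega))
    omega
  have h₁ := dvd_stirlingSecond_sub_sum (q := p ^ e) (N := p ^ e) (b := b) (d := d) hr
    (pow_dvd_pow p (by omega : e ≤ e + 1))
    (by simpa using prime_pow_dvd_revRisingProd_sub p e) (J := A' + 1) (by omega : A < A' + 1)
  have h₂ := dvd_stirlingSecond_sub_sum (q := p ^ e) (N := p ^ e) (b := b) (d := d)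
    (mul_ne_zero hr hp.ne_zero) (pow_dvd_pow p (by omega : e ≤ e + 2))
    (by simpa using prime_pow_dvd_revRisingProd_succ_sub p e) (Nat.lt_succ_self A')
  rw [Nat.cast_pow] at h₁ h₂
  set c : ℕ → ℤ := fun j => coeff j (invOneSubPow ℤ (p ^ e * b)).val with hc
  have h₃ : (p : ℤ) ^ e ∣ (p : ℤ) ^ m * d.factorial *
      (∑ j ∈ range (A' + 1), c j * (if (p - 1) * p * j ≤ A' then
          (Nat.stirlingSecond (A' - (p - 1) * p * j) d : ℤ) else 0) -
        ∑ j ∈ range (A' + 1), c j * if (p - 1) * j ≤ A then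
          (Nat.stirlingSecond (A - (p - 1) * j) d : ℤ) else 0) := by
    rw [← sum_sub_distrib, mul_sum]
    refine dvd_sum fun j _ => ?_
    have hcj : (p : ℤ) ^ e ∣ j * c j := by
      have := natCast_dvd_mul_coeff_invOneSubPow (p ^ e * b) j
      push_cast at this
      exact (dvd_mul_right _ _).trans this
    obtain ⟨u, v, hu, hv, huv⟩ := exists_dvd_and_dvd_of_dvd_mul hcj
    obtain ⟨t, hte, hut⟩ := (dvd_prime_pow (Nat.prime_iff_prime_int.1 hp) e).1
      (Dvd.intro v huv.symm)
    have htj : p ^ t ∣ j := by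
      exact_mod_cast hut.symm.dvd.trans hu
    have h := prime_pow_dvd_ite_stirlingSecond_sub (p := p) (t := t) (T := p ^ (e + 1) * m)
      (B := (p - 1) * j) hA (by rw [hA', ← mul_assoc, ← pow_succ'])
      ((pow_dvd_pow p (by omega)).mul_right m) (htj.mul_left _) d
    rw [← mul_assoc, mul_comm p (p - 1)] at h
    rw [huv]
    convert mul_dvd_mul (hut.dvd.trans h) hv using 1
    ring
  have h₄ := (dvd_sub h₂ h₁).mul_left ((p : ℤ) ^ m * d.factorial)
  refine (dvd_add h₄ h₃).trans (dvd_of_eq ?_)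
  simp only [hc]
  ring

theorem exists_tendsto_of_prime_pow_dvd (p : ℕ) [Fact p.Prime] (s : ℕ → ℤ) {c : ℤ} (hc : c ≠ 0)
    (h : ∀ e, (p : ℤ) ^ e ∣ c * (s (e + 1) - s e)) :
    ∃ L : ℤ_[p], Filter.Tendsto (fun e => (s e : ℤ_[p])) Filter.atTop (nhds L) := by
  have hp := (Fact.out : p.Prime)
  have hcpos : 0 < ‖(c : ℤ_[p])‖ := norm_pos_iff.2 (Int.cast_ne_zero.2 hc)
  refine cauchySeq_tendsto_of_complete (cauchySeq_of_le_geometric ((p : ℝ)⁻¹)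
    (‖(c : ℤ_[p])‖⁻¹) (inv_lt_one_of_one_lt₀ (by exact_mod_cast hp.one_lt)) fun e => ?_)
  have h₁ := PadicInt.norm_int_le_pow_iff_dvd.2 (h e)
  rw [Int.cast_mul, norm_mul, zpow_neg, zpow_natCast, ← inv_pow, Int.cast_sub] at h₁
  rw [dist_comm, dist_eq_norm, inv_mul_eq_div, le_div_iff₀ hcpos, mul_comm]
  exact h₁

end PadicStirling

theorem padic_limit_stirling2_shifted_exists (p : ℕ) [Fact p.Prime] (a b d : ℤ)
    (hb : 0 ≤ b) (hba : b ≤ a) (hd : 1 ≤ d) :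
    ∃ L : ℤ_[p],
      Filter.Tendsto
        (fun e : ℕ =>
          ((stirling2 ((p : ℤ) ^ (e + 1) * a - (a - b)) ((p : ℤ) ^ (e + 1) * b + d) : ℤ) :
            ℤ_[p]))
        Filter.atTop (nhds L) := by
  have hp := (Fact.out : p.Prime)
  lift b to ℕ using hb
  lift d to ℕ using by omega
  obtain ⟨m, rfl⟩ := Int.le.dest hba
  have hle : ∀ e, m ≤ p ^ e * m := fun e => Nat.le_mul_of_pos_left _ (pow_pos hp.pos e)
  have hS : ∀ e : ℕ, stirling2 ((p : ℤ) ^ (e + 1) * (b + m) - (b + m - b))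
      ((p : ℤ) ^ (e + 1) * b + d) =
      Nat.stirlingSecond (p ^ (e + 1) * m - m + p ^ (e + 1) * b) (p ^ (e + 1) * b + d) := by
    intro e
    rw [← PadicStirling.stirling2_natCast]
    congr 1
    · push_cast [Nat.cast_sub (hle (e + 1))]
      ring
  refine PadicStirling.exists_tendsto_of_prime_pow_dvd p _ (c := (p : ℤ) ^ m * d.factorial) ?_ ?_
  · exact mul_ne_zero (pow_ne_zero _ (by exact_mod_cast hp.ne_zero))
      (by exact_mod_cast d.factorial_ne_zero)
  · intro e
    rw [hS, hS]
    exact PadicStirling.prime_pow_dvd_stirlingSecond_succ_sub p b d m e _ _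
      (Nat.sub_add_cancel (hle _)) (Nat.sub_add_cancel (hle _))
end

section
/- Let p be a prime and a, b integers with 1 ≤ b < a. Then there exists E such that for every e ≥ E and every integer j with 0 ≤ j ≤ R_p(e)·(a−b), one has ν_p( C(p^e·b + j − 1, j) ) + (p^{e+1} − 1)(a−b) − (p−1)·j ≥ e − log_p(a − b + p). -/
/-- `R_p(e) = 1 + p + ⋯ + p^e = (p^{e+1} - 1)/(p - 1)`. -/
def Rp (p e : ℕ) : ℕ := ∑ i ∈ Finset.range (e + 1), p ^ i

theorem sub_one_mul_Rp (p e : ℕ) : ((p : ℤ) - 1) * Rp p e = (p : ℤ) ^ (e + 1) - 1 := by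
  rw [Rp, Nat.cast_sum, ← mul_geom_sum]
  simp

/-- Since `j * C(n + j - 1, j) = n * C(n + j - 1, j - 1)`, a power `p ^ e` dividing `n` divides
`C(n + j - 1, j)` up to a factor which is a power of `p` dividing `j`. -/
theorem exists_pow_dvd_and_le_padicValNat_choose (p : ℕ) [hp : Fact p.Prime] {e n : ℕ}
    (hn : n ≠ 0) (hen : p ^ e ∣ n) (j : ℕ) :
    ∃ v, p ^ v ∣ j ∧ e ≤ v + padicValNat p ((n + j - 1).choose j) := by
  rcases j with _ | j
  · exact ⟨e, dvd_zero _, Nat.le_add_right _ _⟩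
  refine ⟨padicValNat p (j + 1), pow_padicValNat_dvd, ?_⟩
  have hmul : (n + j).choose (j + 1) * (j + 1) = (n + j).choose j * n := by
    simpa using Nat.choose_succ_right_eq (n + j) j
  have hpos : (n + j).choose (j + 1) ≠ 0 := (Nat.choose_pos (by omega)).ne'
  rw [← Nat.add_assoc, Nat.add_sub_cancel, ← padicValNat.mul j.succ_ne_zero hpos, mul_comm, hmul,
    ← padicValNat_dvd_iff_le (by simp [hn, (Nat.choose_pos (Nat.le_add_left j n)).ne'])]
  exact hen.mul_left _

theorem add_le_add_mul_pow {p : ℕ} (hp : 2 ≤ p) (d m : ℕ) : d + m ≤ (d + p) * p ^ m := by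
  have hm : m + 1 ≤ p ^ m := Nat.lt_pow_self hp
  nlinarith [Nat.zero_le (d * m)]

theorem padicValNat_choose_lower_bound (p : ℕ) [Fact p.Prime] (a b : ℤ)
    (hb : 1 ≤ b) (hba : b < a) :
    ∃ E : ℕ, ∀ e : ℕ, E ≤ e → ∀ j : ℤ, 0 ≤ j → j ≤ (Rp p e : ℤ) * (a - b) →
      (e : ℝ) - Real.logb p ((a : ℝ) - (b : ℝ) + (p : ℝ)) ≤
        (padicValNat p (Nat.choose ((p : ℤ) ^ e * b + j - 1).toNat j.toNat) : ℝ) +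
          ((p : ℝ) ^ (e + 1) - 1) * ((a : ℝ) - (b : ℝ)) - ((p : ℝ) - 1) * (j : ℝ) := by
  have hp2 : 2 ≤ p := (Fact.out : p.Prime).two_le
  refine ⟨0, fun e _ j hj0 hj => ?_⟩
  obtain ⟨d, rfl⟩ : ∃ d : ℕ, a = b + d := ⟨(a - b).toNat, by omega⟩
  lift b to ℕ using by omega
  lift j to ℕ using hj0
  simp only [add_sub_cancel_left] at hj
  obtain ⟨k, hk⟩ : ∃ k : ℕ, Rp p e * d = j + k :=
    Nat.exists_eq_add_of_le (by exact_mod_cast hj)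
  have hn : p ^ e * b ≠ 0 := by
    have : b ≠ 0 := by omega
    positivity
  have htop : ((p : ℤ) ^ e * b + j - 1).toNat = p ^ e * b + j - 1 := by
    zify [show 1 ≤ p ^ e * b + j by omega]
    rw [Int.toNat_of_nonneg]
    have : (1 : ℤ) ≤ (p : ℤ) ^ e * b := by exact_mod_cast Nat.one_le_iff_ne_zero.mpr hn
    omega
  rw [htop, Int.toNat_natCast]
  obtain ⟨v, hvj, hv⟩ := exists_pow_dvd_and_le_padicValNat_choose p hn (dvd_mul_right _ b) j
  set c := padicValNat p ((p ^ e * b + j - 1).choose j)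
  have hkZ : (Rp p e : ℤ) * d = j + k := by exact_mod_cast hk
  have hdefect : ((p : ℤ) ^ (e + 1) - 1) * d - (p - 1) * j = (p - 1) * k := by
    rw [← sub_one_mul_Rp, mul_assoc, hkZ]
    ring
  have hdvd : p ^ min v e ∣ d + (p - 1) * k := by
    zify [show 1 ≤ p by omega]
    have h1 : (p : ℤ) ^ min v e ∣ j := by
      exact_mod_cast (pow_dvd_pow p (min_le_left v e)).trans hvj
    have h2 : (p : ℤ) ^ min v e ∣ p ^ (e + 1) := pow_dvd_pow _ (by omega)
    have h3 : (d : ℤ) + (p - 1) * k = p ^ (e + 1) * d - (p - 1) * j := by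
      linear_combination -hdefect
    rw [h3]
    exact (h2.mul_right _).sub (h1.mul_left _)
  have hle : p ^ min v e ≤ (d + p) * p ^ ((p - 1) * k) :=
    (Nat.le_of_dvd (by omega) hdvd).trans (add_le_add_mul_pow hp2 _ _)
  have hpR : (1 : ℝ) < p := by exact_mod_cast hp2
  have hdp : (0 : ℝ) < d + p := by positivity
  have hlog : ((min v e : ℕ) : ℝ) ≤ Real.logb p (d + p) + (p - 1) * k := by
    have hleR : (p : ℝ) ^ min v e ≤ (d + p) * p ^ ((p - 1) * k) := by exact_mod_cast hle
    have h := Real.logb_le_logb_of_le hpR (by positivity) hleR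
    rw [Real.logb_mul hdp.ne' (by positivity), Real.logb_pow, Real.logb_pow,
      Real.logb_self_eq_one hpR] at h
    simpa [Nat.cast_sub (show 1 ≤ p by omega)] using h
  have hdefectR : ((p : ℝ) ^ (e + 1) - 1) * d - (p - 1) * j = (p - 1) * k := by
    exact_mod_cast hdefect
  have hsum : (e : ℝ) ≤ (min v e : ℕ) + (c : ℝ) := by
    exact_mod_cast (by omega : e ≤ min v e + c)
  push_cast at hlog hsum ⊢
  simp only [add_sub_cancel_left]
  linarith
end

section
/- Let p be a prime, α and b positive integers, and ℓ ≥ 0 an integer. Then the sequence e ↦ C(p^e·b + R_p(e)·α, p^e·b + ℓ), viewed in ℤ_p, converges as e → ∞. -/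
open Filter Topology

/-- The product of the integers in `[1, p * n]` that are not divisible by `p`. -/
def primeToPart (p n : ℕ) : ℕ := ∏ j ∈ Finset.range n, (p * j + 1).ascFactorial (p - 1)

theorem factorial_mul_eq_primeToPart {p : ℕ} (hp : 0 < p) (n : ℕ) :
    (p * n).factorial = p ^ n * n.factorial * primeToPart p n := by
  induction n with
  | zero => simp [primeToPart]
  | succ n ih =>
    obtain ⟨q, rfl⟩ := Nat.exists_eq_succ_of_ne_zero hp.ne'
    rw [mul_add_one, ← Nat.factorial_mul_ascFactorial, ih, Nat.succ_eq_add_one,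
      Nat.ascFactorial_succ, primeToPart, primeToPart, Finset.prod_range_succ,
      Nat.factorial_succ, Nat.add_sub_cancel]
    ring

theorem ascFactorial_modEq {m a b : ℕ} (h : a ≡ b [MOD m]) (k : ℕ) :
    a.ascFactorial k ≡ b.ascFactorial k [MOD m] := by
  induction k with
  | zero => exact Nat.ModEq.refl _
  | succ k ih =>
    rw [Nat.ascFactorial_succ, Nat.ascFactorial_succ]
    exact (h.add_right k).mul ih

theorem primeToPart_add_modEq (p e K M : ℕ) (hM : p ^ e ∣ M) :
    primeToPart p (K + M) ≡ primeToPart p K * primeToPart p M [MOD p ^ (e + 1)] := by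
  induction K with
  | zero => simp [primeToPart, Nat.ModEq.refl]
  | succ K ih =>
    have h : p * (K + M) + 1 ≡ p * K + 1 [MOD p ^ (e + 1)] := by
      have h0 : p * M ≡ 0 [MOD p ^ (e + 1)] := by
        rw [Nat.modEq_zero_iff_dvd, pow_succ']
        exact Nat.mul_dvd_mul_left p hM
      have := (h0.add_left (p * K)).add_right 1
      rwa [← mul_add, add_zero] at this
    rw [show K + 1 + M = K + M + 1 by ring, primeToPart, Finset.prod_range_succ,
      primeToPart, Finset.prod_range_succ]
    refine (ih.mul (ascFactorial_modEq h (p - 1))).trans ?_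
    rw [mul_right_comm]
    rfl

theorem coprime_primeToPart {p : ℕ} (hp : p.Prime) (n : ℕ) : p.Coprime (primeToPart p n) := by
  refine Nat.Coprime.prod_right fun j _ => ?_
  rw [Nat.ascFactorial_eq_prod_range]
  refine Nat.Coprime.prod_right fun i hi => ?_
  rw [hp.coprime_iff_not_dvd, add_assoc, Nat.dvd_add_right (Dvd.intro _ rfl)]
  have := Finset.mem_range.1 hi
  exact Nat.not_dvd_of_pos_of_lt (by lia) (by lia)

theorem choose_mul_modEq {p : ℕ} (hp : p.Prime) (e K M : ℕ) (hM : p ^ e ∣ M) :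
    (p * (K + M)).choose (p * M) ≡ (K + M).choose M [MOD p ^ (e + 1)] := by
  have key : (p * (K + M)).choose (p * M) * (primeToPart p K * primeToPart p M) =
      (K + M).choose M * primeToPart p (K + M) := by
    have h1 := Nat.add_choose_mul_factorial_mul_factorial (p * K) (p * M)
    have h2 := Nat.add_choose_mul_factorial_mul_factorial K M
    rw [← mul_add, factorial_mul_eq_primeToPart hp.pos, factorial_mul_eq_primeToPart hp.pos,
      factorial_mul_eq_primeToPart hp.pos, ← h2] at h1
    have hpos : 0 < p ^ (K + M) * K.factorial * M.factorial :=
      Nat.mul_pos (Nat.mul_pos (pow_pos hp.pos _) K.factorial_pos) M.factorial_pos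
    refine Nat.eq_of_mul_eq_mul_left hpos ?_
    rw [pow_add] at h1 ⊢
    linear_combination h1
  have hcop : (p ^ (e + 1)).gcd (primeToPart p (K + M)) = 1 :=
    Nat.Coprime.pow_left _ (coprime_primeToPart hp _)
  refine Nat.ModEq.cancel_right_of_coprime hcop ?_
  rw [← key]
  exact (primeToPart_add_modEq p e K M hM).mul_left _

theorem choose_mul_add_modEq {p : ℕ} (hp : p.Prime) (e K M α : ℕ) (hM : p ^ e ∣ M) :
    (p * M + (p * K + α)).choose (p * M) * (p * K + 1).ascFactorial α ≡
      (K + M).choose M * (p * K + 1).ascFactorial α [MOD p ^ (e + 1)] := by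
  have key : (p * M + (p * K + α)).choose (p * M) * (p * K + 1).ascFactorial α =
      (p * (K + M)).choose (p * M) * (p * (K + M) + 1).ascFactorial α := by
    have h1 := Nat.add_choose_mul_factorial_mul_factorial (p * K) (p * M)
    have h2 := Nat.add_choose_mul_factorial_mul_factorial (p * K + α) (p * M)
    have h3 := Nat.factorial_mul_ascFactorial (p * K) α
    have h4 := Nat.factorial_mul_ascFactorial (p * (K + M)) α
    rw [show p * K + α + p * M = p * M + (p * K + α) by ring, ← h3] at h2
    rw [show p * (K + M) + α = p * M + (p * K + α) by ring, ← h2, mul_add, ← h1] at h4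
    refine Nat.eq_of_mul_eq_mul_left
      (Nat.mul_pos (p * K).factorial_pos (p * M).factorial_pos) ?_
    rw [mul_add]
    linear_combination -h4
  rw [key]
  refine (choose_mul_modEq hp e K M hM).mul (ascFactorial_modEq ?_ α)
  have h0 : p * M ≡ 0 [MOD p ^ (e + 1)] := by
    rw [Nat.modEq_zero_iff_dvd, pow_succ']
    exact Nat.mul_dvd_mul_left p hM
  have := (h0.add_left (p * K)).add_right 1
  rwa [← mul_add, add_zero] at this

theorem Rp_succ (p e : ℕ) : Rp p (e + 1) = p * Rp p e + 1 := by
  rw [Rp, Finset.sum_range_succ', Rp, Finset.mul_sum]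
  simp [pow_succ']

theorem norm_natCast_prime_lt_one (p : ℕ) [Fact p.Prime] : ‖(p : ℤ_[p])‖ < 1 :=
  PadicInt.norm_natCast_lt_one_iff.2 dvd_rfl

theorem tendsto_Rp (p : ℕ) [Fact p.Prime] :
    ∃ L : ℤ_[p], (1 - (p : ℤ_[p])) * L = 1 ∧
      Tendsto (fun e => (Rp p e : ℤ_[p])) atTop (𝓝 L) := by
  have hs : Summable fun n : ℕ => (p : ℤ_[p]) ^ n :=
    summable_geometric_of_norm_lt_one (norm_natCast_prime_lt_one p)
  refine ⟨∑' n : ℕ, (p : ℤ_[p]) ^ n, mul_neg_geom_series _ (norm_natCast_prime_lt_one p), ?_⟩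
  have := (tendsto_add_atTop_iff_nat 1).2 hs.hasSum.tendsto_sum_nat
  simpa [Rp] using this

theorem norm_natCast_sub_le_of_modEq {p : ℕ} [Fact p.Prime] {a b n : ℕ}
    (h : a ≡ b [MOD p ^ n]) : ‖(a : ℤ_[p]) - b‖ ≤ ((p : ℝ)⁻¹) ^ n := by
  have := (PadicInt.norm_int_le_pow_iff_dvd (p := p) (k := (a : ℤ) - b) (n := n)).2
    (by simpa using Nat.modEq_iff_dvd.1 h.symm)
  simpa using this

theorem tendsto_choose_pow_mul (p : ℕ) [hp : Fact p.Prime] (α b : ℕ) :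
    ∃ L : ℤ_[p], Tendsto
      (fun e : ℕ => ((p ^ e * b + Rp p e * α).choose (p ^ e * b) : ℤ_[p])) atTop (𝓝 L) := by
  obtain ⟨L, hL, hR⟩ := tendsto_Rp p
  set D : ℕ → ℕ := fun e => (p * (Rp p e * α) + 1).ascFactorial α with hD
  have hDlim : Tendsto (fun e => (D e : ℤ_[p])) atTop
      (𝓝 (∏ i ∈ Finset.range α, ((p : ℤ_[p]) * (L * α) + 1 + i))) := by
    simp only [hD, Nat.ascFactorial_eq_prod_range]
    push_cast
    exact tendsto_finsetProd _ fun i _ =>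
      (((hR.mul_const _).const_mul _).add_const _).add_const _
  have hlim0 : ∏ i ∈ Finset.range α, ((p : ℤ_[p]) * (L * α) + 1 + i) ≠ 0 := by
    refine Finset.prod_ne_zero_iff.2 fun i hi h => ?_
    have h2 : ((p * α + (1 + i) : ℕ) : ℤ_[p]) = ((p * (1 + i) : ℕ) : ℤ_[p]) := by
      push_cast
      linear_combination (1 - (p : ℤ_[p])) * h - (p : ℤ_[p]) * α * hL
    have h3 := Nat.cast_injective h2
    have h4 : p * (1 + i) ≤ p * α := Nat.mul_le_mul_left p (by have := Finset.mem_range.1 hi; lia)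
    lia
  have hD0 (e : ℕ) : 0 < ‖(D e : ℤ_[p])‖ :=
    norm_pos_iff.2 (Nat.cast_ne_zero.2 (Nat.ascFactorial_pos _ _).ne')
  obtain ⟨C, hC⟩ := (hDlim.norm.inv₀ (norm_ne_zero_iff.2 hlim0)).bddAbove_range
  refine cauchySeq_tendsto_of_complete
    (cauchySeq_of_le_geometric (p : ℝ)⁻¹ (C * (p : ℝ)⁻¹) ?_ fun e => ?_)
  · exact inv_lt_one_of_one_lt₀ (mod_cast hp.out.one_lt)
  · have h := norm_natCast_sub_le_of_modEq
      (choose_mul_add_modEq hp.out e (Rp p e * α) (p ^ e * b) α (Dvd.intro _ rfl))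
    rw [show p * (p ^ e * b) + (p * (Rp p e * α) + α) = p ^ (e + 1) * b + Rp p (e + 1) * α by
        rw [Rp_succ]; ring, show p * (p ^ e * b) = p ^ (e + 1) * b by ring,
      add_comm (Rp p e * α)] at h
    push_cast only [Nat.cast_mul] at h
    rw [← sub_mul, norm_mul, ← le_div_iff₀ (hD0 e)] at h
    rw [dist_comm, dist_eq_norm]
    refine h.trans ?_
    rw [div_eq_mul_inv, mul_comm, mul_assoc, ← pow_succ']
    exact mul_le_mul_of_nonneg_right (hC ⟨e, rfl⟩) (by positivity)

theorem padic_limit_choose_exists (p : ℕ) [Fact p.Prime] (α b ℓ : ℕ)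
    (hα : 1 ≤ α) (hb : 1 ≤ b) :
    ∃ L : ℤ_[p],
      Filter.Tendsto
        (fun e : ℕ => ((Nat.choose (p ^ e * b + Rp p e * α) (p ^ e * b + ℓ) : ℕ) : ℤ_[p]))
        Filter.atTop (nhds L) := by
  obtain ⟨A, hA⟩ := tendsto_choose_pow_mul p α b
  obtain ⟨L, -, hR⟩ := tendsto_Rp p
  have hB : Tendsto (fun e : ℕ => ((p ^ e * b + ℓ).choose ℓ : ℤ_[p])) atTop (𝓝 1) := by
    have h1 : Tendsto (fun e : ℕ => ((p ^ e * b + ℓ : ℕ) : ℤ_[p])) atTop (𝓝 (ℓ : ℤ_[p])) := by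
      have := ((tendsto_pow_atTop_nhds_zero_of_norm_lt_one
        (norm_natCast_prime_lt_one p)).mul_const (b : ℤ_[p])).add_const (ℓ : ℤ_[p])
      simpa using this
    have := ((PadicInt.continuous_choose (p := p) ℓ).tendsto _).comp h1
    simpa [Function.comp_def, Ring.choose_natCast, -Nat.cast_add] using this
  have hC : Tendsto (fun e : ℕ => ((Rp p e * α).choose ℓ : ℤ_[p])) atTop
      (𝓝 (Ring.choose (L * α) ℓ)) := by
    have h1 : Tendsto (fun e : ℕ => ((Rp p e * α : ℕ) : ℤ_[p])) atTop (𝓝 (L * α)) := by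
      push_cast
      exact hR.mul_const _
    have := ((PadicInt.continuous_choose (p := p) ℓ).tendsto _).comp h1
    simpa [Function.comp_def, Ring.choose_natCast, -Nat.cast_mul] using this
  refine ⟨A * Ring.choose (L * α) ℓ, ?_⟩
  have hdiff : Tendsto (fun e : ℕ => ((p ^ e * b + Rp p e * α).choose (p ^ e * b + ℓ) : ℤ_[p]) *
      (1 - ((p ^ e * b + ℓ).choose ℓ : ℤ_[p]))) atTop (𝓝 0) := by
    refine squeeze_zero_norm (a := fun e => ‖1 - ((p ^ e * b + ℓ).choose ℓ : ℤ_[p])‖)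
      (fun e => ?_) ?_
    · rw [norm_mul]
      exact mul_le_of_le_one_left (norm_nonneg _) (PadicInt.norm_le_one _)
    · simpa using (hB.const_sub 1).norm
  have := hdiff.add (hA.mul hC)
  rw [zero_add] at this
  refine this.congr fun e => ?_
  have h := Nat.choose_mul (n := p ^ e * b + Rp p e * α) (Nat.le_add_right (p ^ e * b) ℓ)
  rw [Nat.add_sub_cancel_left, Nat.add_sub_cancel_left, Nat.choose_symm_add] at h
  have h' := congrArg (Nat.cast : ℕ → ℤ_[p]) h
  rw [Nat.cast_mul, Nat.cast_mul] at h'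
  linear_combination -h'
end

section
/- Let p be a prime, α and b positive integers, and ℓ ≥ 0 an integer. Write α = (p−1)·t + Δ with integers t ≥ 0 and 1 ≤ Δ ≤ p−1, and let s be the minimal nonnegative integer such that Δ·(p^s − 1)/(p−1) − t − ℓ ≥ 0. Then for every integer e > s, ν_p( C(p^e·b + R_p(e)·α, p^e·b + ℓ) ) = ν_p( C(p·t + b + Δ, b) ) + ν_p( C(Δ·(p^s − 1)/(p−1) − t, ℓ) ); in particular this valuation is independent of e for e > s. -/
/-- `G_p(s) = 1 + p + ⋯ + p^{s-1} = (p^s - 1)/(p - 1)`. -/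
def Gp (p s : ℕ) : ℕ := ∑ i ∈ Finset.range s, p ^ i

theorem sub_one_mul_padicValNat_choose_add_sum_digits (p : ℕ) [Fact p.Prime] (k m : ℕ) :
    (p - 1) * padicValNat p (Nat.choose (k + m) k) + (p.digits (k + m)).sum =
      (p.digits k).sum + (p.digits m).sum := by
  have hval : padicValNat p (k + m).factorial =
      padicValNat p (Nat.choose (k + m) k) + padicValNat p k.factorial +
        padicValNat p m.factorial := by
    have hc : Nat.choose (k + m) k ≠ 0 := (Nat.choose_pos (Nat.le_add_right k m)).ne'
    rw [← padicValNat.mul hc k.factorial_ne_zero,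
      ← padicValNat.mul (mul_ne_zero hc k.factorial_ne_zero) m.factorial_ne_zero,
      show m.factorial = (k + m - k).factorial by rw [Nat.add_sub_cancel_left],
      Nat.choose_mul_factorial_mul_factorial (Nat.le_add_right k m)]
  have legendre (n : ℕ) : (p - 1) * padicValNat p n.factorial + (p.digits n).sum = n := by
    rw [sub_one_mul_padicValNat_factorial, Nat.sub_add_cancel (Nat.digit_sum_le p n)]
  have h₁ := legendre (k + m)
  have h₂ := legendre k
  have h₃ := legendre m
  rw [hval, mul_add, mul_add] at h₁
  omega

theorem sum_digits_pow_mul_add {p : ℕ} (hp : 1 < p) (e A c : ℕ) (hc : c < p ^ e) :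
    (p.digits (p ^ e * A + c)).sum = (p.digits A).sum + (p.digits c).sum := by
  have step (n : ℕ) : (p.digits n).sum = n % p + (p.digits (n / p)).sum := by
    rcases n.eq_zero_or_pos with rfl | hn
    · simp
    · rw [Nat.digits_def' hp hn, List.sum_cons]
  induction e generalizing c with
  | zero =>
    obtain rfl : c = 0 := by simpa using hc
    simp
  | succ e ih =>
    have hn : p ^ (e + 1) * A + c = c + p * (p ^ e * A) := by ring
    rw [step, step c, hn, Nat.add_mul_mod_self_left, Nat.add_mul_div_left _ _ (by omega),
      add_comm (c / p), ih _ (Nat.div_lt_of_lt_mul (by rwa [pow_succ'] at hc))]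
    omega

theorem padicValNat_choose_pow_mul_add (p : ℕ) [Fact p.Prime] {e A b c l : ℕ}
    (hb : b ≤ A) (hl : l ≤ c) (hc : c < p ^ e) :
    padicValNat p (Nat.choose (p ^ e * A + c) (p ^ e * b + l)) =
      padicValNat p (Nat.choose A b) + padicValNat p (Nat.choose c l) := by
  have hp : 1 < p := (Fact.out : p.Prime).one_lt
  obtain ⟨a, rfl⟩ := Nat.exists_eq_add_of_le hb
  obtain ⟨d, rfl⟩ := Nat.exists_eq_add_of_le hl
  have hn : p ^ e * (b + a) + (l + d) = (p ^ e * b + l) + (p ^ e * a + d) := by ring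
  have h := sub_one_mul_padicValNat_choose_add_sum_digits p (p ^ e * b + l) (p ^ e * a + d)
  rw [← hn, sum_digits_pow_mul_add hp e _ _ hc, sum_digits_pow_mul_add hp e b l (by omega),
    sum_digits_pow_mul_add hp e a d (by omega)] at h
  have h₁ := sub_one_mul_padicValNat_choose_add_sum_digits p b a
  have h₂ := sub_one_mul_padicValNat_choose_add_sum_digits p l d
  apply Nat.eq_of_mul_eq_mul_left (Nat.sub_pos_of_lt hp)
  rw [mul_add (p - 1)]
  omega

theorem sub_one_mul_Gp_add_one {p : ℕ} (hp : 1 ≤ p) (s : ℕ) : (p - 1) * Gp p s + 1 = p ^ s := by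
  obtain ⟨q, rfl⟩ := Nat.exists_eq_add_of_le' hp
  rw [Gp, Nat.add_sub_cancel, mul_comm, geom_sum_mul_add]

theorem Gp_add (p s r : ℕ) : Gp p (s + r) = p ^ s * Gp p r + Gp p s := by
  simp only [Gp, Finset.sum_range_add, Finset.mul_sum, pow_add]
  exact add_comm _ _

theorem padicValNat_choose_eventually_constant (p : ℕ) [Fact p.Prime]
    (α b ℓ t Δ s : ℕ) (hb : 1 ≤ b)
    (hΔ1 : 1 ≤ Δ) (hΔ2 : Δ ≤ p - 1) (hα : α = (p - 1) * t + Δ)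
    (hs : t + ℓ ≤ Δ * Gp p s) (hsmin : ∀ s' : ℕ, s' < s → ¬ (t + ℓ ≤ Δ * Gp p s')) :
    ∀ e : ℕ, s < e →
      padicValNat p (Nat.choose (p ^ e * b + Rp p e * α) (p ^ e * b + ℓ)) =
        padicValNat p (Nat.choose (p * t + b + Δ) b) +
          padicValNat p (Nat.choose (Δ * Gp p s - t) ℓ) := by
  intro e he
  have hp : 1 ≤ p := (Fact.out : p.Prime).one_le
  have hlt (n : ℕ) : Δ * Gp p n < p ^ n := by
    have h₁ := sub_one_mul_Gp_add_one hp n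
    have h₂ := Nat.mul_le_mul_right (Gp p n) hΔ2
    omega
  obtain ⟨r, rfl⟩ := Nat.exists_eq_add_of_le he.le
  have hG : Δ * Gp p (s + r) - t = p ^ s * (Δ * Gp p r) + (Δ * Gp p s - t) := by
    rw [Gp_add, mul_add, mul_left_comm]
    omega
  have hle : t + ℓ ≤ Δ * Gp p (s + r) := by
    rw [Gp_add, mul_add]
    omega
  have hR : p ^ (s + r) * b + Rp p (s + r) * α =
      p ^ (s + r) * (p * t + b + Δ) + (Δ * Gp p (s + r) - t) := by
    have hRG : Rp p (s + r) = Gp p (s + r) + p ^ (s + r) := by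
      rw [Rp, Finset.sum_range_succ, Gp]
    have hgeom := sub_one_mul_Gp_add_one hp (s + r)
    obtain ⟨q, rfl⟩ := Nat.exists_eq_add_of_le hp
    simp only [Nat.add_sub_cancel_left] at hgeom hα
    zify [show t ≤ Δ * Gp (1 + q) (s + r) by omega] at hgeom ⊢
    rw [hRG, hα]
    push_cast
    linear_combination (t : ℤ) * hgeom
  have hlow := padicValNat_choose_pow_mul_add p (e := s) (Nat.zero_le (Δ * Gp p r))
    (show ℓ ≤ Δ * Gp p s - t by omega) ((Nat.sub_le _ _).trans_lt (hlt s))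
  rw [hR, padicValNat_choose_pow_mul_add p (by omega) (by omega)
    ((Nat.sub_le _ _).trans_lt (hlt _)), hG]
  simpa using hlow
end

section
/- For every integer d ≥ 1, either T_2(d−1, d) = 0 or ν_2(T_2(d−1, d)) ≥ d/2 − 1 (equivalently, 2·ν_2(T_2(d−1,d)) ≥ d − 2). -/
/-- Partial Stirling numbers
`T_p(n,k) = ((-1)^k/k!) ∑_{0 ≤ i ≤ k, p ∤ i} (-1)^i C(k,i) i^n`. -/
def partialStirling (p : ℕ) (n k : ℕ) : ℚ :=
  ((-1 : ℚ) ^ k / (Nat.factorial k : ℚ)) *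
    ∑ i ∈ Finset.range (k + 1),
      if ¬ (p ∣ i) then (-1 : ℚ) ^ i * (Nat.choose k i : ℚ) * (i : ℚ) ^ n else 0

open Finset Nat

lemma sum_range_two_mul {M : Type*} [AddCommMonoid M] (f : ℕ → M) (n : ℕ) :
    ∑ i ∈ range (2 * n), f i = ∑ j ∈ range n, (f (2 * j) + f (2 * j + 1)) := by
  induction n with
  | zero => simp
  | succ n ih => rw [mul_add, mul_one, sum_range_succ, sum_range_succ, ih, sum_range_succ, add_assoc]

lemma sum_choose_odd {n N : ℕ} (h : n + 1 ≤ N) :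
    ∑ j ∈ range N, (n + 1).choose (2 * j + 1) = 2 ^ n := by
  simp_rw [choose_succ_succ']
  rw [← sum_range_two_mul (fun i => n.choose i), ← sum_range_choose]
  refine (sum_subset (range_subset_range.2 (by omega)) fun i _ hi => ?_).symm
  exact choose_eq_zero_of_lt (by simpa using hi)

lemma sum_choose_odd_mul_choose_succ {d N : ℕ} (k : ℕ) (h : d ≤ 2 * N) :
    ∑ j ∈ range (N + 1), (d + 2).choose (2 * j + 1) * j.choose (k + 1) =
      2 * ∑ j ∈ range (N + 1), (d + 1).choose (2 * j + 1) * j.choose (k + 1) +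
        ∑ j ∈ range N, d.choose (2 * j + 1) * j.choose k := by
  have hd : ∑ j ∈ range N, d.choose (2 * j + 3) * (j + 1).choose (k + 1) =
      ∑ j ∈ range N, d.choose (2 * j + 1) * j.choose (k + 1) := by
    have h1 := sum_range_succ' (fun j => d.choose (2 * j + 1) * j.choose (k + 1)) N
    have h2 := sum_range_succ (fun j => d.choose (2 * j + 1) * j.choose (k + 1)) N
    rw [choose_eq_zero_of_lt (by omega : d < 2 * N + 1)] at h2
    simpa [h2, mul_add] using h1.symm
  rw [sum_range_succ', sum_range_succ' _ N]
  simp only [choose_zero_succ, mul_zero, add_zero]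
  have e (j : ℕ) : 2 * (j + 1) + 1 = 2 * j + 1 + 1 + 1 := by ring
  simp only [e, choose_succ_succ' (d + 1), choose_succ_succ' d, add_mul, sum_add_distrib] at hd ⊢
  rw [hd]
  simp only [choose_succ_succ' _ k, mul_add, sum_add_distrib]
  ring

lemma sum_choose_odd_mul_choose {k n N : ℕ} (h : k + 1 + n ≤ N) :
    ∑ j ∈ range N, (k + 1 + n).choose (2 * j + 1) * j.choose k = n.choose k * 2 ^ (n - k) := by
  induction n generalizing k N with
  | zero =>
    cases k with
    | zero => simpa using sum_choose_odd (n := 0) h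
    | succ k =>
      rw [choose_zero_succ, zero_mul]
      refine sum_eq_zero fun j _ => ?_
      rcases lt_or_ge j (k + 1) with hj | hj
      · rw [choose_eq_zero_of_lt hj, mul_zero]
      · rw [choose_eq_zero_of_lt (by omega), zero_mul]
  | succ n ih =>
    cases k with
    | zero =>
      rw [show 0 + 1 + (n + 1) = n + 1 + 1 by ring] at h ⊢
      simpa using sum_choose_odd h
    | succ k =>
      obtain ⟨N, rfl⟩ : ∃ M, N = M + 1 := ⟨N - 1, by omega⟩
      have h1 := ih (k := k + 1) (N := N + 1) (by omega)
      have h2 := ih (k := k) (N := N) (by omega)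
      rw [show k + 1 + 1 + n = k + 1 + n + 1 by ring] at h1
      rw [show k + 1 + 1 + (n + 1) = k + 1 + n + 2 by ring,
        sum_choose_odd_mul_choose_succ k (by omega), h1, h2, choose_succ_succ',
        Nat.add_sub_add_right]
      rcases lt_or_ge n (k + 1) with hn | hn
      · simp [choose_eq_zero_of_lt hn]
      · rw [show n - k = n - (k + 1) + 1 by omega]
        ring

lemma succ_pow_eq_sum_choose (n : ℕ) :
    ∃ c : ℕ → ℕ, ∀ j, (j + 1) ^ n = ∑ k ∈ range (n + 1), c k * k ! * j.choose k := by
  induction n with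
  | zero => exact ⟨fun _ => 1, by simp⟩
  | succ n ih =>
    obtain ⟨c, hc⟩ := ih
    refine ⟨fun k => (if k = n + 1 then 0 else (k + 1) * c k) + (if k = 0 then 0 else c (k - 1)),
      fun j => ?_⟩
    rw [pow_succ, hc]
    simp only [add_mul _ _ (_ !), add_mul _ _ (j.choose _), sum_add_distrib]
    rw [sum_range_succ _ (n + 1), if_pos rfl,
      sum_range_succ' (fun k => (if k = 0 then 0 else c (k - 1)) * k ! * j.choose k)]
    simp only [add_tsub_cancel_right, if_neg (succ_ne_zero _), if_true, zero_mul, add_zero]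
    rw [← sum_add_distrib, sum_mul]
    refine sum_congr rfl fun k hk => ?_
    rw [if_neg (by have := mem_range.1 hk; omega), factorial_succ]
    have := add_one_mul_choose_eq j k
    rw [choose_succ_succ' j k] at this
    have e : (j + 1) * j.choose k = (k + 1) * j.choose k + (k + 1) * j.choose (k + 1) := by
      linarith
    calc c k * k ! * j.choose k * (j + 1) = c k * k ! * ((j + 1) * j.choose k) := by ring
      _ = _ := by rw [e]; ring

lemma two_mul_padicValNat_two_le (m : ℕ) : 2 * padicValNat 2 m ≤ m := by
  rcases Nat.eq_zero_or_pos m with rfl | hm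
  · simp
  · have h := Nat.le_of_dvd hm (pow_padicValNat_dvd (p := 2) (n := m))
    refine le_trans ?_ h
    generalize padicValNat 2 m = v
    rcases v with _ | v
    · simp
    · have := v.lt_two_pow_self
      rw [pow_succ]
      omega

lemma padicValNat_two_factorial_add_le (k m : ℕ) :
    2 * (padicValNat 2 (2 * k + 1 + m)! + padicValNat 2 m !) ≤
      2 * padicValNat 2 (2 * (k + m))! + m := by
  rcases m with _ | m
  · have := padicValNat_factorial_mul_add (p := 2) (n := 1) k (by norm_num)
    simp [this]
  · have h := (padicValNat_dvd_iff_le (p := 2) (factorial_ne_zero (2 * (k + (m + 1))))).1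
      (pow_padicValNat_dvd.trans (show (2 * k + 1 + (m + 1))! * m ! ∣ _ by
        rw [show 2 * (k + (m + 1)) = 2 * k + 1 + (m + 1) + m by ring]
        exact factorial_mul_factorial_dvd_factorial_add _ _))
    rw [padicValNat.mul (factorial_ne_zero _) (factorial_ne_zero _)] at h
    rw [factorial_succ m, padicValNat.mul (by omega) (factorial_ne_zero _)]
    have := two_mul_padicValNat_two_le (m + 1)
    omega

lemma two_pow_dvd_factorial_mul_choose (k m : ℕ) :
    2 ^ ((2 * k + 1 + m) / 2 + padicValNat 2 (2 * k + 1 + m)!) ∣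
      2 ^ (2 * k + m) * (k ! * ((k + m).choose k * 2 ^ m)) := by
  have hc : (k + m).choose k ≠ 0 := (choose_pos (by omega)).ne'
  rw [padicValNat_dvd_iff_le (by simp [hc, factorial_ne_zero])]
  have hf := congrArg (padicValNat 2) (choose_mul_factorial_mul_factorial (Nat.le_add_right k m))
  rw [Nat.add_sub_cancel_left,
    padicValNat.mul (mul_ne_zero hc (factorial_ne_zero _))
      (factorial_ne_zero _),
    padicValNat.mul hc (factorial_ne_zero _)] at hf
  rw [padicValNat.mul (by positivity) (by simp [hc, factorial_ne_zero]),
    padicValNat.mul (factorial_ne_zero _) (by simp [hc]),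
    padicValNat.mul hc (by positivity), padicValNat.prime_pow, padicValNat.prime_pow]
  have h1 := padicValNat_two_factorial_add_le k m
  have h2 := padicValNat_factorial_mul (p := 2) (k + m)
  omega

lemma two_pow_dvd_sum_choose_odd_mul_pow (e : ℕ) :
    2 ^ ((e + 1) / 2 + padicValNat 2 (e + 1)!) ∣
      2 ^ e * ∑ j ∈ range (e + 1), (e + 1).choose (2 * j + 1) * (j + 1) ^ e := by
  obtain ⟨c, hc⟩ := succ_pow_eq_sum_choose e
  have hsum : 2 ^ e * ∑ j ∈ range (e + 1), (e + 1).choose (2 * j + 1) * (j + 1) ^ e =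
      ∑ k ∈ range (e + 1), ∑ j ∈ range (e + 1),
        2 ^ e * ((e + 1).choose (2 * j + 1) * (c k * k ! * j.choose k)) := by
    rw [sum_comm]
    simp only [hc, mul_sum]
  rw [hsum]
  refine dvd_sum fun k hk => ?_
  obtain ⟨n, rfl⟩ : ∃ n, e = k + n := ⟨e - k, by have := mem_range.1 hk; omega⟩
  have h := sum_choose_odd_mul_choose (k := k) (n := n) (N := k + n + 1) (by omega)
  rw [show k + 1 + n = k + n + 1 by ring] at h
  have hs : ∑ j ∈ range (k + n + 1), 2 ^ (k + n) * ((k + n + 1).choose (2 * j + 1) *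
      (c k * k ! * j.choose k)) = c k * (2 ^ (k + n) * (k ! * (n.choose k * 2 ^ (n - k)))) := by
    rw [← h]
    simp only [mul_sum]
    exact sum_congr rfl fun j _ => by ring
  rw [hs]
  rcases lt_or_ge n k with hn | hn
  · simp [choose_eq_zero_of_lt hn]
  · obtain ⟨m, rfl⟩ := Nat.exists_eq_add_of_le hn
    have := two_pow_dvd_factorial_mul_choose k m
    rw [show k + (k + m) + 1 = 2 * k + 1 + m by ring, show k + (k + m) = 2 * k + m by ring,
      Nat.add_sub_cancel_left]
    exact this.mul_left _

lemma sum_even_choose_mul_pow (e : ℕ) :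
    ∑ i ∈ range (e + 3), (if 2 ∣ i then (e + 2).choose i * i ^ (e + 1) else 0) =
      (e + 2) * (2 ^ e * ∑ j ∈ range (e + 1), (e + 1).choose (2 * j + 1) * (j + 1) ^ e) := by
  have h : ∑ i ∈ range (e + 3), (if 2 ∣ i then (e + 2).choose i * i ^ (e + 1) else 0) =
      ∑ i ∈ range (2 * (e + 1) + 1), (if 2 ∣ i then (e + 2).choose i * i ^ (e + 1) else 0) := by
    refine sum_subset (range_subset_range.2 (by omega)) fun i _ hi => ?_
    rw [choose_eq_zero_of_lt (by simp at hi; omega)]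
    simp
  rw [h, sum_range_succ', sum_range_two_mul]
  simp only [mul_sum]
  simp only [dvd_zero, if_true, pow_succ, mul_zero, add_zero]
  refine sum_congr rfl fun j _ => ?_
  rw [if_neg (by omega), if_pos (by omega), zero_add]
  have := add_one_mul_choose_eq (e + 1) (2 * j + 1)
  calc (e + 2).choose (2 * j + 1 + 1) * ((2 * j + 1 + 1) ^ e * (2 * j + 1 + 1))
      = ((e + 1 + 1).choose (2 * j + 1 + 1) * (2 * j + 1 + 1)) * (2 * (j + 1)) ^ e := by ring
    _ = _ := by rw [← this, mul_pow]; ring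

lemma partialStirling_two_eq_sum_even {n k : ℕ} (h : n < k) :
    partialStirling 2 n k = (-1) ^ (k + 1) / (k ! : ℚ) *
      ((∑ i ∈ range (k + 1), (if 2 ∣ i then k.choose i * i ^ n else 0) : ℕ) : ℚ) := by
  have h0 : ∑ i ∈ range (k + 1), (-1 : ℚ) ^ i * k.choose i * (i : ℚ) ^ n = 0 := by
    have := congrFun (fwdDiff_iter_pow_eq_zero_of_lt (R := ℚ) h) 0
    rw [fwdDiff_iter_eq_sum_shift] at this
    have h2 := congrArg (fun x => (-1 : ℚ) ^ k * x) this
    simp only [mul_sum, Pi.zero_apply, mul_zero] at h2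
    rw [← h2]
    refine sum_congr rfl fun i hi => ?_
    obtain ⟨m, rfl⟩ := Nat.exists_eq_add_of_le (Nat.lt_succ_iff.1 (mem_range.1 hi))
    have hm : ((-1 : ℚ) ^ m) * (-1) ^ m = 1 := by rw [← mul_pow]; simp
    simp only [Nat.add_sub_cancel_left, zsmul_eq_mul, pow_add]
    push_cast
    simp only [nsmul_eq_mul, mul_one, zero_add]
    linear_combination (-(-1 : ℚ) ^ i * (i + m).choose i * (i : ℚ) ^ n) * hm
  rw [partialStirling, pow_succ]
  push_cast
  have hs : (∑ i ∈ range (k + 1),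
      if ¬ (2 ∣ i) then (-1 : ℚ) ^ i * (k.choose i : ℚ) * (i : ℚ) ^ n else 0) +
      ∑ i ∈ range (k + 1), (if 2 ∣ i then (k.choose i : ℚ) * (i : ℚ) ^ n else 0) = 0 := by
    rw [← sum_add_distrib]
    refine Eq.trans ?_ h0
    refine sum_congr rfl fun i _ => ?_
    by_cases hi : 2 ∣ i
    · simp [hi, (even_iff_two_dvd.2 hi).neg_one_pow]
    · simp [hi]
  linear_combination (-1 : ℚ) ^ k / (k ! : ℚ) * hs

theorem two_adic_val_partialStirling (d : ℕ) (hd : 1 ≤ d) :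
    partialStirling 2 (d - 1) d = 0 ∨
    (d : ℤ) - 2 ≤ 2 * padicValRat 2 (partialStirling 2 (d - 1) d) := by
  rw [or_iff_not_imp_left]
  intro hne
  obtain rfl | ⟨e, rfl⟩ : d = 1 ∨ ∃ e, d = e + 2 := by
    rcases d with _ | _ | e
    · omega
    · exact Or.inl rfl
    · exact Or.inr ⟨e, rfl⟩
  · simp [partialStirling, sum_range_succ]
  · rw [Nat.add_sub_assoc (by norm_num)] at hne ⊢
    rw [partialStirling_two_eq_sum_even (by omega), sum_even_choose_mul_pow] at hne ⊢
    have hdvd := two_pow_dvd_sum_choose_odd_mul_pow e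
    generalize 2 ^ e * ∑ j ∈ range (e + 1), (e + 1).choose (2 * j + 1) * (j + 1) ^ e = S at *
    have hS : S ≠ 0 := by rintro rfl; simp at hne
    rw [padicValNat_dvd_iff_le hS] at hdvd
    have hq : (-1) ^ (e + 2 + 1) / ((e + 2)! : ℚ) * (((e + 2) * S : ℕ) : ℚ) =
        (-1) ^ (e + 2 + 1) * ((S : ℚ) / ((e + 1)! : ℕ)) := by
      rw [factorial_succ (e + 1)]
      push_cast
      field_simp
      ring
    have hv : padicValRat 2 ((-1) ^ (e + 2 + 1) * ((S : ℚ) / ((e + 1)! : ℕ))) =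
        padicValNat 2 S - padicValNat 2 (e + 1)! := by
      have h1 : padicValRat 2 ((S : ℚ) / ((e + 1)! : ℕ)) =
          padicValNat 2 S - padicValNat 2 (e + 1)! := by
        rw [padicValRat.div (by exact_mod_cast hS) (by exact_mod_cast factorial_ne_zero _)]
        simp
      rcases neg_one_pow_eq_or ℚ (e + 2 + 1) with h | h <;> simp [h, h1]
    rw [hq, hv]
    omega
end
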